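/- arXiv:2402.15382 — 3 statements merged into one kernel-verified Lean document; each statement's English description precedes it below -/
import Mathlib

section
/- For every formula φ of the language L_{[<ω]}, the following are equivalent: (1) φ is a theorem of GLP.3; (2) every closed substitution of φ is a theorem of GLP; (3) φ is a theorem of some non-degenerate normal extension of GLP. -/
/-- Formulas of the polymodal language `L_{[<ω]}`: propositional variables,
a constant ⊤, Boolean connectives, and a modality `[m]` for each `m : ℕ`. -/
inductive Formula : Type
  | var : ℕ → Formula
  | top : Formula
  | neg : Formula → Formula
  | and : Formula → Formula → Formula
  | or : Formula → Formula → Formula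
  | imp : Formula → Formula → Formula
  | box : ℕ → Formula → Formula
  deriving DecidableEq

namespace Formula

/-- `⊥` abbreviates `¬⊤`. -/
def bot : Formula := neg top

/-- `⟨m⟩φ` abbreviates `¬[m]¬φ`. -/
def dia (m : ℕ) (φ : Formula) : Formula := neg (box m (neg φ))

/-- A formula is closed if it contains no propositional variables. -/
def Closed : Formula → Prop
  | var _ => False
  | top => True
  | neg a => Closed a
  | and a b => Closed a ∧ Closed b
  | or a b => Closed a ∧ Closed b
  | imp a b => Closed a ∧ Closed b
  | box _ a => Closed a

/-- Membership in the language `L_{[<n]}`: all modalities `[m]` have `m < n`. -/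
def InLang (n : ℕ) : Formula → Prop
  | var _ => True
  | top => True
  | neg a => InLang n a
  | and a b => InLang n a ∧ InLang n b
  | or a b => InLang n a ∧ InLang n b
  | imp a b => InLang n a ∧ InLang n b
  | box m a => m < n ∧ InLang n a

/-- Uniform substitution of formulas for propositional variables. -/
def subst (σ : ℕ → Formula) : Formula → Formula
  | var i => σ i
  | top => top
  | neg a => neg (subst σ a)
  | and a b => and (subst σ a) (subst σ b)
  | or a b => or (subst σ a) (subst σ b)
  | imp a b => imp (subst σ a) (subst σ b)
  | box m a => box m (subst σ a)

/-- The number of occurrences of modal operators in a formula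
(diamonds `⟨m⟩` are abbreviations `¬[m]¬`, so each is one box occurrence). -/
def modalCount : Formula → ℕ
  | var _ => 0
  | top => 0
  | neg a => modalCount a
  | and a b => modalCount a + modalCount b
  | or a b => modalCount a + modalCount b
  | imp a b => modalCount a + modalCount b
  | box _ a => modalCount a + 1

end Formula

/-- Conjunction of a finite list of formulas. -/
def bigConj (l : List Formula) : Formula := l.foldr Formula.and Formula.top

/-- `⋀_{m ≤ k < n} [k]φ`. -/
def boxConj (m n : ℕ) (φ : Formula) : Formula :=
  bigConj ((List.range' m (n - m)).map fun k => Formula.box k φ)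

/-- The pseudo-linearity axiom
`[m]((⋀_{m≤k<n}[k]φ) → ψ) ∨ [m]((⋀_{m≤k<n}[k]ψ ∧ ψ) → φ)`. -/
def psLin (n m : ℕ) (φ ψ : Formula) : Formula :=
  Formula.or
    (Formula.box m (Formula.imp (boxConj m n φ) ψ))
    (Formula.box m (Formula.imp (Formula.and (boxConj m n ψ) ψ) φ))

/-- A Boolean valuation of formulas respecting the Boolean connectives
(treating boxed formulas and variables as atoms). -/
def RespectsBool (v : Formula → Bool) : Prop :=
  v Formula.top = true ∧
  (∀ a, v (Formula.neg a) = !(v a)) ∧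
  (∀ a b, v (Formula.and a b) = (v a && v b)) ∧
  (∀ a b, v (Formula.or a b) = (v a || v b)) ∧
  (∀ a b, v (Formula.imp a b) = (!(v a) || v b))

/-- Propositional tautologies of the modal language. -/
def Tautology (φ : Formula) : Prop :=
  ∀ v : Formula → Bool, RespectsBool v → v φ = true

/-- Japaridze's polymodal provability logic `GLP`. -/
inductive GLP : Formula → Prop
  | taut {φ : Formula} : Tautology φ → GLP φ
  | distr (m : ℕ) (φ ψ : Formula) :
      GLP (Formula.imp (Formula.box m (Formula.imp φ ψ))
        (Formula.imp (Formula.box m φ) (Formula.box m ψ)))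
  | lob (m : ℕ) (φ : Formula) :
      GLP (Formula.imp (Formula.box m (Formula.imp (Formula.box m φ) φ)) (Formula.box m φ))
  | mono (m : ℕ) (φ : Formula) :
      GLP (Formula.imp (Formula.box m φ) (Formula.box (m + 1) φ))
  | diaMono (m : ℕ) (φ : Formula) :
      GLP (Formula.imp (Formula.dia m φ) (Formula.box (m + 1) (Formula.dia m φ)))
  | mp {φ ψ : Formula} : GLP (Formula.imp φ ψ) → GLP φ → GLP ψ
  | nec (m : ℕ) {φ : Formula} : GLP φ → GLP (Formula.box m φ)

/-- The logic `GLP.3`: `GLP` together with the linearity axioms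
`[m]([m]A → B) ∨ [m]([m]B ∧ B → A)`. -/
inductive GLP3 : Formula → Prop
  | taut {φ : Formula} : Tautology φ → GLP3 φ
  | distr (m : ℕ) (φ ψ : Formula) :
      GLP3 (Formula.imp (Formula.box m (Formula.imp φ ψ))
        (Formula.imp (Formula.box m φ) (Formula.box m ψ)))
  | lob (m : ℕ) (φ : Formula) :
      GLP3 (Formula.imp (Formula.box m (Formula.imp (Formula.box m φ) φ)) (Formula.box m φ))
  | mono (m : ℕ) (φ : Formula) :
      GLP3 (Formula.imp (Formula.box m φ) (Formula.box (m + 1) φ))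
  | diaMono (m : ℕ) (φ : Formula) :
      GLP3 (Formula.imp (Formula.dia m φ) (Formula.box (m + 1) (Formula.dia m φ)))
  | lin (m : ℕ) (A B : Formula) :
      GLP3 (Formula.or (Formula.box m (Formula.imp (Formula.box m A) B))
        (Formula.box m (Formula.imp (Formula.and (Formula.box m B) B) A)))
  | mp {φ ψ : Formula} : GLP3 (Formula.imp φ ψ) → GLP3 φ → GLP3 ψ
  | nec (m : ℕ) {φ : Formula} : GLP3 φ → GLP3 (Formula.box m φ)

/-- The logic `GLP_n`, i.e. `GLP` restricted to the language `L_{[<n]}`. -/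
inductive GLPn (n : ℕ) : Formula → Prop
  | taut {φ : Formula} : Tautology φ → Formula.InLang n φ → GLPn n φ
  | distr {m : ℕ} (hm : m < n) (φ ψ : Formula)
      (hφ : Formula.InLang n φ) (hψ : Formula.InLang n ψ) :
      GLPn n (Formula.imp (Formula.box m (Formula.imp φ ψ))
        (Formula.imp (Formula.box m φ) (Formula.box m ψ)))
  | lob {m : ℕ} (hm : m < n) (φ : Formula) (hφ : Formula.InLang n φ) :
      GLPn n (Formula.imp (Formula.box m (Formula.imp (Formula.box m φ) φ)) (Formula.box m φ))
  | mono {m : ℕ} (hm : m + 1 < n) (φ : Formula) (hφ : Formula.InLang n φ) :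
      GLPn n (Formula.imp (Formula.box m φ) (Formula.box (m + 1) φ))
  | diaMono {m : ℕ} (hm : m + 1 < n) (φ : Formula) (hφ : Formula.InLang n φ) :
      GLPn n (Formula.imp (Formula.dia m φ) (Formula.box (m + 1) (Formula.dia m φ)))
  | mp {φ ψ : Formula} : GLPn n (Formula.imp φ ψ) → GLPn n φ → GLPn n ψ
  | nec {m : ℕ} (hm : m < n) {φ : Formula} : GLPn n φ → GLPn n (Formula.box m φ)

/-- The logic `GLP_n.3`: `GLP_n` with the linearity axioms for each `m < n`. -/
inductive GLPn3 (n : ℕ) : Formula → Prop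
  | taut {φ : Formula} : Tautology φ → Formula.InLang n φ → GLPn3 n φ
  | distr {m : ℕ} (hm : m < n) (φ ψ : Formula)
      (hφ : Formula.InLang n φ) (hψ : Formula.InLang n ψ) :
      GLPn3 n (Formula.imp (Formula.box m (Formula.imp φ ψ))
        (Formula.imp (Formula.box m φ) (Formula.box m ψ)))
  | lob {m : ℕ} (hm : m < n) (φ : Formula) (hφ : Formula.InLang n φ) :
      GLPn3 n (Formula.imp (Formula.box m (Formula.imp (Formula.box m φ) φ)) (Formula.box m φ))
  | mono {m : ℕ} (hm : m + 1 < n) (φ : Formula) (hφ : Formula.InLang n φ) :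
      GLPn3 n (Formula.imp (Formula.box m φ) (Formula.box (m + 1) φ))
  | diaMono {m : ℕ} (hm : m + 1 < n) (φ : Formula) (hφ : Formula.InLang n φ) :
      GLPn3 n (Formula.imp (Formula.dia m φ) (Formula.box (m + 1) (Formula.dia m φ)))
  | lin {m : ℕ} (hm : m < n) (A B : Formula)
      (hA : Formula.InLang n A) (hB : Formula.InLang n B) :
      GLPn3 n (Formula.or (Formula.box m (Formula.imp (Formula.box m A) B))
        (Formula.box m (Formula.imp (Formula.and (Formula.box m B) B) A)))
  | mp {φ ψ : Formula} : GLPn3 n (Formula.imp φ ψ) → GLPn3 n φ → GLPn3 n ψ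
  | nec {m : ℕ} (hm : m < n) {φ : Formula} : GLPn3 n φ → GLPn3 n (Formula.box m φ)

/-- Beklemishev's logic `J_n`. -/
inductive Jn (n : ℕ) : Formula → Prop
  | taut {φ : Formula} : Tautology φ → Formula.InLang n φ → Jn n φ
  | distr {k : ℕ} (hk : k < n) (φ ψ : Formula)
      (hφ : Formula.InLang n φ) (hψ : Formula.InLang n ψ) :
      Jn n (Formula.imp (Formula.box k (Formula.imp φ ψ))
        (Formula.imp (Formula.box k φ) (Formula.box k ψ)))
  | lob {k : ℕ} (hk : k < n) (φ : Formula) (hφ : Formula.InLang n φ) :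
      Jn n (Formula.imp (Formula.box k (Formula.imp (Formula.box k φ) φ)) (Formula.box k φ))
  | trans1 {k m : ℕ} (hkm : k ≤ m) (hm : m < n) (φ : Formula) (hφ : Formula.InLang n φ) :
      Jn n (Formula.imp (Formula.box k φ) (Formula.box k (Formula.box m φ)))
  | trans2 {k m : ℕ} (hkm : k ≤ m) (hm : m < n) (φ : Formula) (hφ : Formula.InLang n φ) :
      Jn n (Formula.imp (Formula.box k φ) (Formula.box m (Formula.box k φ)))
  | diaMono {k m : ℕ} (hkm : k < m) (hm : m < n) (φ : Formula) (hφ : Formula.InLang n φ) :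
      Jn n (Formula.imp (Formula.dia k φ) (Formula.box m (Formula.dia k φ)))
  | mp {φ ψ : Formula} : Jn n (Formula.imp φ ψ) → Jn n φ → Jn n ψ
  | nec {k : ℕ} (hk : k < n) {φ : Formula} : Jn n φ → Jn n (Formula.box k φ)

/-- The logic `J_n.lin`: `J_n` together with the pseudo-linearity axioms. -/
inductive JnLin (n : ℕ) : Formula → Prop
  | taut {φ : Formula} : Tautology φ → Formula.InLang n φ → JnLin n φ
  | distr {k : ℕ} (hk : k < n) (φ ψ : Formula)
      (hφ : Formula.InLang n φ) (hψ : Formula.InLang n ψ) :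
      JnLin n (Formula.imp (Formula.box k (Formula.imp φ ψ))
        (Formula.imp (Formula.box k φ) (Formula.box k ψ)))
  | lob {k : ℕ} (hk : k < n) (φ : Formula) (hφ : Formula.InLang n φ) :
      JnLin n (Formula.imp (Formula.box k (Formula.imp (Formula.box k φ) φ)) (Formula.box k φ))
  | trans1 {k m : ℕ} (hkm : k ≤ m) (hm : m < n) (φ : Formula) (hφ : Formula.InLang n φ) :
      JnLin n (Formula.imp (Formula.box k φ) (Formula.box k (Formula.box m φ)))
  | trans2 {k m : ℕ} (hkm : k ≤ m) (hm : m < n) (φ : Formula) (hφ : Formula.InLang n φ) :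
      JnLin n (Formula.imp (Formula.box k φ) (Formula.box m (Formula.box k φ)))
  | diaMono {k m : ℕ} (hkm : k < m) (hm : m < n) (φ : Formula) (hφ : Formula.InLang n φ) :
      JnLin n (Formula.imp (Formula.dia k φ) (Formula.box m (Formula.dia k φ)))
  | lin {m : ℕ} (hm : m < n) (φ ψ : Formula)
      (hφ : Formula.InLang n φ) (hψ : Formula.InLang n ψ) :
      JnLin n (psLin n m φ ψ)
  | mp {φ ψ : Formula} : JnLin n (Formula.imp φ ψ) → JnLin n φ → JnLin n ψ
  | nec {k : ℕ} (hk : k < n) {φ : Formula} : JnLin n φ → JnLin n (Formula.box k φ)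

section Frames

variable {T : Type*}

/-- `(T, <_0, …, <_{n-1})` (encoded as `R : ℕ → T → T → Prop`, only the
relations `R i` for `i < n` being relevant) is a `J_n`-frame. -/
def IsJnFrame (n : ℕ) (R : ℕ → T → T → Prop) : Prop :=
  (∀ i < n, Irreflexive (R i)) ∧
  (∀ i < n, Transitive (R i)) ∧
  (∀ i < n, WellFounded fun a b => R i b a) ∧
  ∀ ⦃k m : ℕ⦄, k < m → m < n →
    (∀ ⦃x y z : T⦄, R m x y → R k y z → R k x z) ∧
    (∀ ⦃x y z : T⦄, R k x y → R m y z → R k x z) ∧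
    (∀ ⦃x y z : T⦄, R k x z → R m y z → R k x y)

/-- A frame is hereditarily linear if any two distinct points are comparable
by some relation `<_k`, `k < n`. -/
def HereditarilyLinear (n : ℕ) (R : ℕ → T → T → Prop) : Prop :=
  ∀ x y : T, x ≠ y → ∃ k < n, R k x y ∨ R k y x

/-- A frame is stratified if `x <_m y` and `z <_k y` imply `x <_m z` for `k < m < n`. -/
def Stratified (n : ℕ) (R : ℕ → T → T → Prop) : Prop :=
  ∀ ⦃k m : ℕ⦄, k < m → m < n → ∀ ⦃x y z : T⦄, R m x y → R k z y → R m x z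

/-- The relations `≡_k` (for `k ≤ n`): `≡_n` is identity and `≡_k` is the
equivalence relation generated by the union of `<_k` and `≡_{k+1}`.
Equivalence classes of `≡_k` are the `k`-planes. -/
def eqvRel (R : ℕ → T → T → Prop) (n : ℕ) (k : ℕ) : T → T → Prop :=
  if _ : k < n then
    Relation.EqvGen fun x y => R k x y ∨ eqvRel R n (k + 1) x y
  else Eq
termination_by n - k
decreasing_by omega

/-- Kripke satisfaction in the model `(T, R, V)`. -/
def Sat (R : ℕ → T → T → Prop) (V : ℕ → T → Prop) : T → Formula → Prop
  | w, Formula.var p => V p w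
  | _, Formula.top => True
  | w, Formula.neg a => ¬ Sat R V w a
  | w, Formula.and a b => Sat R V w a ∧ Sat R V w b
  | w, Formula.or a b => Sat R V w a ∨ Sat R V w b
  | w, Formula.imp a b => Sat R V w a → Sat R V w b
  | w, Formula.box m a => ∀ v : T, R m w v → Sat R V v a

end Frames

/-- A set of formulas is consistent with the logic `L` if no finite conjunction
of its elements has its negation provable in `L`. -/
def SetConsistent (L : Formula → Prop) (S : Set Formula) : Prop :=
  ∀ l : List Formula, (∀ φ ∈ l, φ ∈ S) → ¬ L (Formula.neg (bigConj l))

/-- A maximal `L`-consistent set of `L_{[<n]}`-formulas. -/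
def MCS (L : Formula → Prop) (n : ℕ) (S : Set Formula) : Prop :=
  (∀ φ ∈ S, Formula.InLang n φ) ∧ SetConsistent L S ∧
  ∀ S' : Set Formula, (∀ φ ∈ S', Formula.InLang n φ) → S ⊆ S' → S ≠ S' → ¬ SetConsistent L S'

/-- The canonical accessibility relation `x <_m y`. -/
def canonR (m : ℕ) (x y : Set Formula) : Prop :=
  (∀ ψ : Formula, Formula.box m ψ ∈ x → ψ ∈ y) ∧
  (∃ ψ : Formula, Formula.box m ψ ∈ y ∧ Formula.box m ψ ∉ x)

/-- A set of formulas is `k`-maximal if it contains `¬ψ ∧ ⋀_{k≤m<n}[m]ψ` for some `ψ`. -/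
def kMaximal (n k : ℕ) (S : Set Formula) : Prop :=
  ∃ ψ : Formula, Formula.and (Formula.neg ψ) (boxConj k n ψ) ∈ S

/-- A normal extension of `GLP`: contains all theorems of `GLP` and all
distribution axioms, and is closed under modus ponens, necessitation for each
modality, and uniform substitution. -/
def NormalExtGLP (S : Set Formula) : Prop :=
  (∀ φ : Formula, GLP φ → φ ∈ S) ∧
  (∀ (m : ℕ) (φ ψ : Formula),
    Formula.imp (Formula.box m (Formula.imp φ ψ))
      (Formula.imp (Formula.box m φ) (Formula.box m ψ)) ∈ S) ∧
  (∀ φ ψ : Formula, Formula.imp φ ψ ∈ S → φ ∈ S → ψ ∈ S) ∧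
  (∀ (m : ℕ) (φ : Formula), φ ∈ S → Formula.box m φ ∈ S) ∧
  (∀ (σ : ℕ → Formula) (φ : Formula), φ ∈ S → Formula.subst σ φ ∈ S)

/-- A logic is non-degenerate if it contains no formula `[m]^k ⊥`. -/
def NonDegenerate (S : Set Formula) : Prop :=
  ∀ m k : ℕ, (fun ψ => Formula.box m ψ)^[k] Formula.bot ∉ S

section ClosedSubstitutions

open Formula

/-- `L` contains `GLP` and is closed under modus ponens and necessitation. -/
structure ExtendsGLP (L : Formula → Prop) : Prop where
  of_glp : ∀ {φ}, GLP φ → L φ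
  mp : ∀ {φ ψ}, L (φ.imp ψ) → L φ → L ψ
  nec : ∀ (m : ℕ) {φ}, L φ → L (φ.box m)

theorem GLP.extendsGLP : ExtendsGLP GLP := ⟨id, GLP.mp, GLP.nec⟩

theorem GLP3.of_glp {φ : Formula} (h : GLP φ) : GLP3 φ := by
  induction h with
  | taut h => exact .taut h
  | distr m φ ψ => exact .distr m φ ψ
  | lob m φ => exact .lob m φ
  | mono m φ => exact .mono m φ
  | diaMono m φ => exact .diaMono m φ
  | mp _ _ ih₁ ih₂ => exact .mp ih₁ ih₂
  | nec m _ ih => exact .nec m ih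

theorem GLP3.extendsGLP : ExtendsGLP GLP3 := ⟨GLP3.of_glp, GLP3.mp, GLP3.nec⟩

/-- Derivability of `φ` from `Γ` over the theorems of `L`, using modus ponens only. -/
inductive Derives (L : Formula → Prop) (Γ : Set Formula) : Formula → Prop
  | thm {φ} : L φ → Derives L Γ φ
  | hyp {φ} : φ ∈ Γ → Derives L Γ φ
  | mp {φ ψ} : Derives L Γ (φ.imp ψ) → Derives L Γ φ → Derives L Γ ψ

/-- A maximal `L`-consistent set of formulas. -/
structure World (L : Formula → Prop) where
  carrier : Set Formula
  thm_mem' : ∀ {φ}, L φ → φ ∈ carrier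
  neg_mem' : ∀ {φ}, φ.neg ∈ carrier ↔ φ ∉ carrier
  imp_mem' : ∀ {φ ψ}, φ.imp ψ ∈ carrier ↔ (φ ∈ carrier → ψ ∈ carrier)

instance (L : Formula → Prop) : Membership Formula (World L) := ⟨fun w φ => φ ∈ w.carrier⟩

variable {L : Formula → Prop}

namespace Derives

theorem taut (hL : ExtendsGLP L) {Γ : Set Formula} {φ : Formula} (h : Tautology φ) :
    Derives L Γ φ :=
  .thm (hL.of_glp (.taut h))

theorem deduction (hL : ExtendsGLP L) {Γ : Set Formula} {φ ψ : Formula}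
    (h : Derives L (insert φ Γ) ψ) : Derives L Γ (φ.imp ψ) := by
  induction h with
  | @thm ψ h =>
    refine .mp (taut hL (φ := ψ.imp (φ.imp ψ)) ?_) (.thm h)
    rintro v ⟨-, hn, ha, ho, hi⟩
    simp only [hi]
    cases v φ <;> cases v ψ <;> rfl
  | @hyp ψ h =>
    rcases h with rfl | h
    · refine taut hL ?_
      rintro v ⟨-, hn, ha, ho, hi⟩
      simp only [hi]
      cases v ψ <;> rfl
    · refine .mp (taut hL (φ := ψ.imp (φ.imp ψ)) ?_) (.hyp h)
      rintro v ⟨-, hn, ha, ho, hi⟩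
      simp only [hi]
      cases v φ <;> cases v ψ <;> rfl
  | @mp α β _ _ ih₁ ih₂ =>
    refine .mp (.mp (taut hL (φ := (φ.imp (α.imp β)).imp ((φ.imp α).imp (φ.imp β))) ?_) ih₁) ih₂
    rintro v ⟨-, hn, ha, ho, hi⟩
    simp only [hi]
    cases v φ <;> cases v α <;> cases v β <;> rfl

theorem mono {Γ Δ : Set Formula} (h : Γ ⊆ Δ) {φ : Formula} (hφ : Derives L Γ φ) :
    Derives L Δ φ := by
  induction hφ with
  | thm h => exact .thm h
  | hyp h₁ => exact .hyp (h h₁)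
  | mp _ _ ih₁ ih₂ => exact .mp ih₁ ih₂

theorem exists_of_sUnion {c : Set (Set Formula)} (hc : IsChain (· ⊆ ·) c) (hne : c.Nonempty)
    {φ : Formula} (h : Derives L (⋃₀ c) φ) : ∃ Γ ∈ c, Derives L Γ φ := by
  induction h with
  | thm h => exact hne.imp fun Γ hΓ => ⟨hΓ, .thm h⟩
  | hyp h =>
    obtain ⟨Γ, hΓ, h⟩ := h
    exact ⟨Γ, hΓ, .hyp h⟩
  | mp _ _ ih₁ ih₂ =>
    obtain ⟨Γ, hΓ, h₁⟩ := ih₁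
    obtain ⟨Δ, hΔ, h₂⟩ := ih₂
    rcases hc.total hΓ hΔ with h | h
    · exact ⟨Δ, hΔ, .mp (h₁.mono h) h₂⟩
    · exact ⟨Γ, hΓ, .mp h₁ (h₂.mono h)⟩

end Derives

theorem World.exists_of_not_derives (hL : ExtendsGLP L) {Γ : Set Formula} {φ : Formula}
    (h : ¬ Derives L Γ φ) : ∃ w : World L, (∀ ψ ∈ Γ, ψ ∈ w) ∧ φ ∉ w := by
  obtain ⟨M, hΓM, hM⟩ := zorn_subset_nonempty {Δ | ¬ Derives L Δ φ}
    (fun c hc hchain hne => ⟨⋃₀ c, fun hd => by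
      obtain ⟨Δ, hΔ, hd⟩ := hd.exists_of_sUnion hchain hne
      exact hc hΔ hd, fun s hs => Set.subset_sUnion_of_mem hs⟩) Γ h
  have hMφ : ¬ Derives L M φ := hM.prop
  have himp : ∀ ψ, ψ ∉ M → Derives L M (ψ.imp φ) := by
    intro ψ hψ
    by_contra hd
    have hins : insert ψ M ∈ {Δ | ¬ Derives L Δ φ} := fun h => hd (h.deduction hL)
    exact hψ (hM.le_of_ge hins (Set.subset_insert _ _) (Set.mem_insert _ _))
  have hclosed : ∀ ψ, Derives L M ψ → ψ ∈ M := by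
    intro ψ hd
    by_contra hψ
    exact hMφ (.mp (himp ψ hψ) hd)
  have hneg : ∀ ψ, ψ.neg ∈ M ↔ ψ ∉ M := by
    intro ψ
    constructor
    · intro h₁ h₂
      refine hMφ (.mp (.mp (.taut hL (φ := ψ.neg.imp (ψ.imp φ)) ?_) (.hyp h₁)) (.hyp h₂))
      rintro v ⟨-, hn, ha, ho, hi⟩
      simp only [hi, hn]
      cases v φ <;> cases v ψ <;> rfl
    · intro h₁
      by_contra h₂
      refine hMφ (.mp (.mp (.taut hL (φ := (ψ.imp φ).imp ((ψ.neg.imp φ).imp φ)) ?_)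
        (himp _ h₁)) (himp _ h₂))
      rintro v ⟨-, hn, ha, ho, hi⟩
      simp only [hi, hn]
      cases v φ <;> cases v ψ <;> rfl
  refine ⟨⟨M, fun h => hclosed _ (.thm h), hneg _, ?_⟩, fun ψ hψ => hΓM hψ,
    fun hφ => hMφ (.hyp hφ)⟩
  intro ψ χ
  constructor
  · exact fun h₁ h₂ => hclosed _ (.mp (.hyp h₁) (.hyp h₂))
  · intro h₁
    by_cases h₂ : ψ ∈ M
    · refine hclosed _ (.mp (.taut hL (φ := χ.imp (ψ.imp χ)) ?_) (.hyp (h₁ h₂)))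
      rintro v ⟨-, hn, ha, ho, hi⟩
      simp only [hi]
      cases v χ <;> cases v ψ <;> rfl
    · refine hclosed _ (.mp (.taut hL (φ := ψ.neg.imp (ψ.imp χ)) ?_) (.hyp ((hneg _).2 h₂)))
      rintro v ⟨-, hn, ha, ho, hi⟩
      simp only [hi, hn]
      cases v χ <;> cases v ψ <;> rfl

namespace World

theorem thm_mem (w : World L) {φ : Formula} (h : L φ) : φ ∈ w := w.thm_mem' h

theorem neg_mem {w : World L} {φ : Formula} : φ.neg ∈ w ↔ φ ∉ w := w.neg_mem'

theorem imp_mem {w : World L} {φ ψ : Formula} : φ.imp ψ ∈ w ↔ (φ ∈ w → ψ ∈ w) := w.imp_mem'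

theorem mp (w : World L) {φ ψ : Formula} (h : L (φ.imp ψ)) (hφ : φ ∈ w) : ψ ∈ w :=
  imp_mem.1 (w.thm_mem h) hφ

theorem top_mem (hL : ExtendsGLP L) (w : World L) : top ∈ w :=
  w.thm_mem (hL.of_glp (.taut fun _ hv => hv.1))

theorem bot_not_mem (hL : ExtendsGLP L) (w : World L) : bot ∉ w :=
  fun h => neg_mem.1 h (w.top_mem hL)

theorem and_mem (hL : ExtendsGLP L) {w : World L} {φ ψ : Formula} :
    φ.and ψ ∈ w ↔ φ ∈ w ∧ ψ ∈ w := by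
  refine ⟨fun h => ⟨w.mp (hL.of_glp (.taut ?_)) h, w.mp (hL.of_glp (.taut ?_)) h⟩,
    fun h => imp_mem.1 (w.mp (φ := φ) (hL.of_glp (.taut ?_)) h.1) h.2⟩ <;>
  · rintro v ⟨-, hn, ha, ho, hi⟩
    simp only [hi, ha]
    cases v φ <;> cases v ψ <;> rfl

theorem or_mem (hL : ExtendsGLP L) {w : World L} {φ ψ : Formula} :
    φ.or ψ ∈ w ↔ φ ∈ w ∨ ψ ∈ w := by
  have h₁ : (φ.or ψ).imp (φ.neg.imp ψ) ∈ w := w.thm_mem (hL.of_glp (.taut (by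
    rintro v ⟨-, hn, ha, ho, hi⟩
    simp only [hi, ho, hn]
    cases v φ <;> cases v ψ <;> rfl)))
  have h₂ : (φ.neg.imp ψ).imp (φ.or ψ) ∈ w := w.thm_mem (hL.of_glp (.taut (by
    rintro v ⟨-, hn, ha, ho, hi⟩
    simp only [hi, ho, hn]
    cases v φ <;> cases v ψ <;> rfl)))
  simp only [imp_mem, neg_mem] at h₁ h₂
  tauto

/-- The canonical accessibility relation of `[m]`. -/
def Rel (m : ℕ) (w v : World L) : Prop := ∀ ψ, box m ψ ∈ w → ψ ∈ v

theorem forall_mem_iff (hL : ExtendsGLP L) {φ : Formula} : (∀ w : World L, φ ∈ w) ↔ L φ := by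
  refine ⟨fun h => ?_, fun h w => w.thm_mem h⟩
  by_contra hφ
  have : ¬ Derives L ∅ φ := by
    intro hd
    apply hφ
    clear h hφ
    induction hd with
    | thm h => exact h
    | hyp h => exact h.elim
    | mp _ _ ih₁ ih₂ => exact hL.mp ih₁ ih₂
  obtain ⟨w, -, hw⟩ := exists_of_not_derives hL this
  exact hw (h w)

theorem box_mem (hL : ExtendsGLP L) {w : World L} {m : ℕ} {φ : Formula} :
    box m φ ∈ w ↔ ∀ v, Rel m w v → φ ∈ v := by
  refine ⟨fun h v hv => hv _ h, fun h => ?_⟩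
  by_contra hφ
  have : ¬ Derives L {ψ | box m ψ ∈ w} φ := by
    intro hd
    apply hφ
    clear h hφ
    induction hd with
    | thm h => exact w.thm_mem (hL.nec m h)
    | hyp h => exact h
    | mp _ _ ih₁ ih₂ => exact imp_mem.1 (w.mp (hL.of_glp (.distr m _ _)) ih₁) ih₂
  obtain ⟨v, hv, hv'⟩ := exists_of_not_derives hL this
  exact hv' (h v hv)

theorem dia_mem (hL : ExtendsGLP L) {w : World L} {m : ℕ} {φ : Formula} :
    dia m φ ∈ w ↔ ∃ v, Rel m w v ∧ φ ∈ v := by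
  simp only [dia, neg_mem, box_mem hL, not_forall, not_not, exists_prop]

theorem box_box_mem (hL : ExtendsGLP L) {w : World L} {m : ℕ} {φ : Formula} (h : box m φ ∈ w) :
    box m (box m φ) ∈ w := by
  have hθ : box m (φ.and (box m φ)) ∈ w := by
    refine w.mp (hL.of_glp (.lob m _)) ((box_mem hL).2 fun v hv => ?_)
    rw [imp_mem, and_mem hL]
    exact fun h₁ => ⟨hv _ h, (box_mem hL).2 fun u hu => ((and_mem hL).1 (hu _ h₁)).1⟩
  exact (box_mem hL).2 fun v hv => ((and_mem hL).1 (hv _ hθ)).2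

theorem Rel.trans (hL : ExtendsGLP L) {m : ℕ} {u v w : World L} (h₁ : Rel m u v)
    (h₂ : Rel m v w) : Rel m u w :=
  fun _ h => h₂ _ (h₁ _ (box_box_mem hL h))

theorem Rel.of_succ (hL : ExtendsGLP L) {m : ℕ} {u v : World L} (h : Rel (m + 1) u v) :
    Rel m u v :=
  fun _ hψ => h _ (u.mp (hL.of_glp (.mono m _)) hψ)

theorem Rel.of_le (hL : ExtendsGLP L) {m n : ℕ} (hmn : m ≤ n) {u v : World L} (h : Rel n u v) :
    Rel m u v := by
  induction hmn with
  | refl => exact h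
  | step _ ih => exact ih (h.of_succ hL)

theorem Rel.box_iff (hL : ExtendsGLP L) {k m : ℕ} (hkm : k < m) {u v : World L}
    (h : Rel m u v) (ψ : Formula) : box k ψ ∈ u ↔ box k ψ ∈ v := by
  have h₁ : Rel (k + 1) u v := h.of_le hL hkm
  constructor
  · exact fun hψ => h₁ _ (u.mp (hL.of_glp (.mono k _)) (box_box_mem hL hψ))
  · contrapose!
    intro hψ
    have hd : dia k ψ.neg ∈ u := by
      rw [box_mem hL] at hψ
      push Not at hψ
      obtain ⟨x, hx, hx'⟩ := hψ
      exact (dia_mem hL).2 ⟨x, hx, neg_mem.2 hx'⟩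
    obtain ⟨x, hx, hx'⟩ := (dia_mem hL).1 (h₁ _ (u.mp (hL.of_glp (.diaMono k _)) hd))
    exact fun hv => neg_mem.1 hx' (hx _ hv)

theorem Rel.dia_iff (hL : ExtendsGLP L) {k m : ℕ} (hkm : k < m) {u v : World L}
    (h : Rel m u v) (ψ : Formula) : dia k ψ ∈ u ↔ dia k ψ ∈ v := by
  simp only [dia, neg_mem, h.box_iff hL hkm]

theorem exists_rel_minimal (hL : ExtendsGLP L) {w : World L} {m : ℕ} {φ : Formula}
    (h : box m φ ∉ w) : ∃ v, Rel m w v ∧ box m φ ∈ v ∧ φ ∉ v := by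
  by_contra! hc
  refine h (w.mp (hL.of_glp (.lob m φ)) ((box_mem hL).2 fun v hv => ?_))
  exact imp_mem.2 (hc v hv)

end World

namespace Formula

/-- The finite set of subformulas of a formula. -/
def subformulas : Formula → Finset Formula
  | var p => {var p}
  | top => {top}
  | neg a => insert (neg a) (subformulas a)
  | and a b => insert (and a b) (subformulas a ∪ subformulas b)
  | or a b => insert (or a b) (subformulas a ∪ subformulas b)
  | imp a b => insert (imp a b) (subformulas a ∪ subformulas b)
  | box m a => insert (box m a) (subformulas a)

/-- Closure of a finite set of formulas under immediate subformulas. -/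
structure SubClosed (Φ : Finset Formula) : Prop where
  neg : ∀ {a}, neg a ∈ Φ → a ∈ Φ
  and : ∀ {a b}, and a b ∈ Φ → a ∈ Φ ∧ b ∈ Φ
  or : ∀ {a b}, or a b ∈ Φ → a ∈ Φ ∧ b ∈ Φ
  imp : ∀ {a b}, imp a b ∈ Φ → a ∈ Φ ∧ b ∈ Φ
  box : ∀ {m a}, box m a ∈ Φ → a ∈ Φ

theorem self_mem_subformulas (φ : Formula) : φ ∈ φ.subformulas := by
  cases φ <;> simp [subformulas]

theorem subClosed_subformulas (φ : Formula) : SubClosed φ.subformulas := by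
  induction φ with
  | var | top => constructor <;> simp [subformulas]
  | neg a ih | box m a ih =>
    have := self_mem_subformulas a
    obtain ⟨h₁, h₂, h₃, h₄, h₅⟩ := ih
    constructor <;> simp only [subformulas, Finset.mem_insert] <;> grind
  | and a b iha ihb | or a b iha ihb | imp a b iha ihb =>
    have := self_mem_subformulas a
    have := self_mem_subformulas b
    obtain ⟨h₁, h₂, h₃, h₄, h₅⟩ := iha
    obtain ⟨k₁, k₂, k₃, k₄, k₅⟩ := ihb
    constructor <;> simp only [subformulas, Finset.mem_insert, Finset.mem_union] <;> grind

theorem SubClosed.union {Φ Ψ : Finset Formula} (hΦ : SubClosed Φ) (hΨ : SubClosed Ψ) :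
    SubClosed (Φ ∪ Ψ) := by
  obtain ⟨h₁, h₂, h₃, h₄, h₅⟩ := hΦ
  obtain ⟨k₁, k₂, k₃, k₄, k₅⟩ := hΨ
  constructor <;> simp only [Finset.mem_union] <;> grind

theorem Closed.of_mem_subformulas {φ ψ : Formula} (h : φ.Closed) (hψ : ψ ∈ φ.subformulas) :
    ψ.Closed := by
  induction φ <;>
    simp only [subformulas, Closed, Finset.mem_insert, Finset.mem_union,
      Finset.mem_singleton] at * <;> grind [Closed]

theorem InLang.of_mem_subformulas {n : ℕ} {φ ψ : Formula} (h : φ.InLang n)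
    (hψ : ψ ∈ φ.subformulas) : ψ.InLang n := by
  induction φ <;>
    simp only [subformulas, InLang, Finset.mem_insert, Finset.mem_union,
      Finset.mem_singleton] at * <;> grind [InLang]

theorem InLang.mono {m n : ℕ} (hmn : m ≤ n) {φ : Formula} (h : φ.InLang m) : φ.InLang n := by
  induction φ <;> simp only [InLang] at * <;> grind

theorem exists_inLang (φ : Formula) : ∃ n, φ.InLang n := by
  induction φ with
  | var | top => exact ⟨0, trivial⟩
  | neg a ih => exact ih
  | box m a ih =>
    obtain ⟨n, hn⟩ := ih
    exact ⟨max (m + 1) n, by omega, hn.mono (le_max_right _ _)⟩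
  | and a b iha ihb | or a b iha ihb | imp a b iha ihb =>
    obtain ⟨m, hm⟩ := iha
    obtain ⟨n, hn⟩ := ihb
    exact ⟨max m n, hm.mono (le_max_left _ _), hn.mono (le_max_right _ _)⟩

end Formula

namespace World

open scoped Classical in
/-- The formulas `ψ ∈ Φ` for which `[m]ψ` fails at `w`. -/
noncomputable def missing (Φ : Finset Formula) (m : ℕ) (w : World L) : Finset Formula :=
  Φ.filter fun ψ => box m ψ ∉ w

theorem mem_missing {Φ : Finset Formula} {m : ℕ} {w : World L} {ψ : Formula} :
    ψ ∈ missing Φ m w ↔ ψ ∈ Φ ∧ box m ψ ∉ w := by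
  simp [missing]

theorem Rel.card_missing_lt (hL : ExtendsGLP L) {Φ : Finset Formula} {m : ℕ} {w v : World L}
    (h : Rel m w v) {ψ : Formula} (hψ : ψ ∈ Φ) (hw : box m ψ ∉ w) (hv : box m ψ ∈ v) :
    (missing Φ m v).card < (missing Φ m w).card := by
  refine Finset.card_lt_card ((Finset.ssubset_iff_of_subset fun χ => ?_).2 ⟨ψ, ?_⟩)
  · simp only [mem_missing]
    exact fun hχ => ⟨hχ.1, fun h₁ => hχ.2 (h _ (box_box_mem hL h₁))⟩
  · simp only [mem_missing]
    tauto

theorem agree_of_agree_box (hL : ExtendsGLP L) {Φ : Finset Formula} (hΦ : SubClosed Φ) {N : ℕ}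
    (hcl : ∀ φ ∈ Φ, φ.Closed) (hN : ∀ φ ∈ Φ, φ.InLang N) {x y : World L}
    (h : ∀ k < N, ∀ ψ ∈ Φ, box k ψ ∈ x ↔ box k ψ ∈ y) (φ : Formula) (hφ : φ ∈ Φ) :
    φ ∈ x ↔ φ ∈ y := by
  induction φ with
  | var p => exact (hcl _ hφ).elim
  | top => simp [top_mem hL]
  | neg a ih => rw [neg_mem, neg_mem, ih (hΦ.neg hφ)]
  | box m a => exact h m (hN _ hφ).1 a (hΦ.box hφ)
  | and a b iha ihb => rw [and_mem hL, and_mem hL, iha (hΦ.and hφ).1, ihb (hΦ.and hφ).2]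
  | or a b iha ihb => rw [or_mem hL, or_mem hL, iha (hΦ.or hφ).1, ihb (hΦ.or hφ).2]
  | imp a b iha ihb => rw [imp_mem, imp_mem, iha (hΦ.imp hφ).1, ihb (hΦ.imp hφ).2]

/-- Two worlds which agree on the boxes below `m` and at which some `Λ ⊆ Φ` fails for the first
time with respect to `[m]` satisfy the same formulas of the finite set `Φ` of closed formulas. -/
theorem agree_of_first_failure (hL : ExtendsGLP L) {Φ : Finset Formula} (hΦ : SubClosed Φ) {N : ℕ}
    (hcl : ∀ φ ∈ Φ, φ.Closed) (hN : ∀ φ ∈ Φ, φ.InLang N) (d : ℕ) :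
    ∀ (m : ℕ), N ≤ m + d → ∀ (c : ℕ) (x y : World L) (Λ : Set Formula),
      (missing Φ m x).card + (missing Φ m y).card ≤ c →
      (∀ k < m, ∀ ψ ∈ Φ, box k ψ ∈ x ↔ box k ψ ∈ y) → (∀ ψ ∈ Λ, ψ ∈ Φ) →
      (∀ ψ ∈ Λ, box m ψ ∈ x ∧ box m ψ ∈ y) → (∃ ψ ∈ Λ, ψ ∉ x) → (∃ ψ ∈ Λ, ψ ∉ y) →
      ∀ ψ ∈ Φ, ψ ∈ x ↔ ψ ∈ y := by
  induction d with
  | zero =>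
    intro m hm c x y Λ _ h _ _ _ _
    exact agree_of_agree_box hL hΦ hcl hN fun k hk => h k (by omega)
  | succ d ihd =>
    intro m hm c
    induction c using Nat.strong_induction_on with
    | _ c ihc =>
    have key : ∀ (x y : World L) (Λ : Set Formula),
        (missing Φ m x).card + (missing Φ m y).card ≤ c →
        (∀ k < m, ∀ ψ ∈ Φ, box k ψ ∈ x ↔ box k ψ ∈ y) → (∀ ψ ∈ Λ, ψ ∈ Φ) →
        (∀ ψ ∈ Λ, box m ψ ∈ x ∧ box m ψ ∈ y) → (∃ ψ ∈ Λ, ψ ∉ x) →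
        ∀ ψ ∈ Φ, box m ψ ∈ x → box m ψ ∈ y := by
      intro x y Λ hc h hΛΦ hΛ hx δ hδ hδx
      by_contra hδy
      obtain ⟨z, hyz, hz, hz'⟩ := exists_rel_minimal hL hδy
      obtain ⟨e, he, hex⟩ := hx
      have hlt := hyz.card_missing_lt hL hδ hδy hz
      have := ihc _ (Nat.lt_of_lt_of_le (Nat.add_lt_add_left hlt _) hc) x z (insert δ Λ) le_rfl
        (fun k hk ψ hψ => (h k hk ψ hψ).trans (hyz.box_iff hL hk ψ))
        (by rintro ψ (rfl | hψ); exacts [hδ, hΛΦ ψ hψ])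
        (by
          rintro ψ (rfl | hψ)
          exacts [⟨hδx, hz⟩, ⟨(hΛ ψ hψ).1, hyz _ (box_box_mem hL (hΛ ψ hψ).2)⟩])
        ⟨e, Or.inr he, hex⟩ ⟨δ, Or.inl rfl, hz'⟩ e (hΛΦ e he)
      exact hex (this.2 (hyz _ (hΛ e he).2))
    intro x y Λ hc h hΛΦ hΛ hx hy
    refine ihd (m + 1) (by omega) _ x y Λ le_rfl (fun k hk ψ hψ => ?_) hΛΦ
      (fun ψ hψ => (hΛ ψ hψ).imp (fun h => x.mp (hL.of_glp (.mono m ψ)) h)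
        (fun h => y.mp (hL.of_glp (.mono m ψ)) h)) hx hy
    rcases Nat.lt_succ_iff_lt_or_eq.1 hk with hk | rfl
    · exact h k hk ψ hψ
    · exact ⟨key x y Λ hc h hΛΦ hΛ hx ψ hψ, key y x Λ (by omega)
        (fun k hk ψ hψ => (h k hk ψ hψ).symm) hΛΦ (fun ψ hψ => (hΛ ψ hψ).symm) hy ψ hψ⟩

end World

/-- The linearity axioms for closed formulas are theorems of `GLP`. -/
theorem GLP.lin_of_closed (m : ℕ) {A B : Formula} (hA : A.Closed) (hB : B.Closed) :
    GLP (((((A.box m).imp B).box m)).or ((((B.box m).and B).imp A).box m)) := by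
  have hL := GLP.extendsGLP
  refine (World.forall_mem_iff hL).1 fun w => (World.or_mem hL).2 ?_
  by_contra! ⟨h₁, h₂⟩
  obtain ⟨x, hwx, hx, hx'⟩ := World.exists_rel_minimal hL h₁
  obtain ⟨y, hwy, hy, hy'⟩ := World.exists_rel_minimal hL h₂
  simp only [World.imp_mem, World.and_mem hL, Classical.not_imp] at hx' hy'
  have hxB : box m B ∈ x := (World.box_mem hL).2 fun v hv =>
    World.imp_mem.1 (hv _ hx) (hv _ (World.box_box_mem hL hx'.1))
  have hyA : box m A ∈ y := (World.box_mem hL).2 fun v hv =>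
    World.imp_mem.1 (hv _ hy)
      ((World.and_mem hL).2 ⟨hv _ (World.box_box_mem hL hy'.1.1), hv _ hy'.1.1⟩)
  obtain ⟨a, ha⟩ := A.exists_inLang
  obtain ⟨b, hb⟩ := B.exists_inLang
  have hAΦ : A ∈ A.subformulas ∪ B.subformulas :=
    Finset.mem_union_left _ A.self_mem_subformulas
  have hBΦ : B ∈ A.subformulas ∪ B.subformulas :=
    Finset.mem_union_right _ B.self_mem_subformulas
  have := World.agree_of_first_failure hL (N := max a b)
    (A.subClosed_subformulas.union B.subClosed_subformulas)
    (fun φ hφ => (Finset.mem_union.1 hφ).elim hA.of_mem_subformulas hB.of_mem_subformulas)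
    (fun φ hφ => (Finset.mem_union.1 hφ).elim
      (ha.mono (le_max_left _ _)).of_mem_subformulas
      (hb.mono (le_max_right _ _)).of_mem_subformulas)
    (max a b) m (by omega) _ x y {A, B} le_rfl
    (fun k hk ψ _ => (hwx.box_iff hL hk ψ).symm.trans (hwy.box_iff hL hk ψ))
    (by rintro ψ (rfl | rfl) <;> assumption)
    (by rintro ψ (rfl | rfl); exacts [⟨hx'.1, hyA⟩, ⟨hxB, hy'.1.1⟩])
    ⟨B, by simp, hx'.2⟩ ⟨A, by simp, hy'.2⟩ B hBΦ
  exact hx'.2 (this.2 hy'.1.2)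

/-- The points of the ordinal model in which only the modalities `[0], …, [N]` are non-trivial. -/
abbrev OrdPoint (N : ℕ) : Type 1 := Fin (N + 1) → Ordinal.{0}

namespace OrdPoint

variable {N : ℕ}

/-- `y` agrees with `x` below coordinate `m` and is smaller at coordinate `m`. -/
def Rel (m : ℕ) (x y : OrdPoint N) : Prop :=
  ∃ h : m < N + 1, (∀ j : Fin (N + 1), j.1 < m → x j = y j) ∧ y ⟨m, h⟩ < x ⟨m, h⟩

theorem Rel.trans {m : ℕ} {x y z : OrdPoint N} (h₁ : Rel m x y) (h₂ : Rel m y z) : Rel m x z := by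
  obtain ⟨h, h₁, h₁'⟩ := h₁
  obtain ⟨_, h₂, h₂'⟩ := h₂
  exact ⟨h, fun j hj => (h₁ j hj).trans (h₂ j hj), h₂'.trans h₁'⟩

theorem wellFounded_exists_rel : WellFounded fun y x : OrdPoint N => ∃ m, Rel m x y := by
  refine Subrelation.wf ?_ (InvImage.wf (toLex : OrdPoint N → Lex (OrdPoint N)) wellFounded_lt)
  rintro y x ⟨m, h, h₁, h₂⟩
  exact ⟨⟨m, h⟩, fun j hj => (h₁ j hj).symm, h₂⟩

theorem wellFounded_rel (m : ℕ) : WellFounded fun y x : OrdPoint N => Rel m x y :=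
  Subrelation.wf (fun h => ⟨m, h⟩) wellFounded_exists_rel

/-- Validity of all instances of `[m]φ → [m+1]φ`. -/
def Monotone (s : Formula → Prop) : Prop := ∀ m φ, s (box m φ) → s (box (m + 1) φ)

/-- Satisfaction at `x` relative to satisfaction at the points below `x`. -/
def satStep (x : OrdPoint N) (S : ∀ y, (∃ m, Rel m x y) → Formula → Prop) : Formula → Prop
  | var _ => False
  | top => True
  | neg a => ¬ satStep x S a
  | Formula.and a b => satStep x S a ∧ satStep x S b
  | Formula.or a b => satStep x S a ∨ satStep x S b
  | imp a b => satStep x S a → satStep x S b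
  | box m a => ∀ y, ∀ h : Rel m x y, Monotone (S y ⟨m, h⟩) → S y ⟨m, h⟩ a

/-- Satisfaction in the ordinal model restricted to the points validating
`[m]φ → [m+1]φ`. -/
noncomputable def sat : OrdPoint N → Formula → Prop := wellFounded_exists_rel.fix satStep

theorem sat_eq (x : OrdPoint N) : sat x = satStep x fun y _ => sat y :=
  wellFounded_exists_rel.fix_eq _ x

/-- The points at which all instances of `[m]φ → [m+1]φ` hold. -/
def Good (x : OrdPoint N) : Prop := Monotone (sat x)

@[simp] theorem sat_top (x : OrdPoint N) : sat x top := by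
  rw [sat_eq]
  trivial

@[simp] theorem sat_neg {x : OrdPoint N} {a : Formula} : sat x (neg a) ↔ ¬ sat x a := by
  rw [sat_eq]
  rfl

@[simp] theorem sat_and {x : OrdPoint N} {a b : Formula} : sat x (Formula.and a b) ↔ sat x a ∧ sat x b := by
  rw [sat_eq]
  rfl

@[simp] theorem sat_or {x : OrdPoint N} {a b : Formula} : sat x (Formula.or a b) ↔ sat x a ∨ sat x b := by
  rw [sat_eq]
  rfl

@[simp] theorem sat_imp {x : OrdPoint N} {a b : Formula} : sat x (imp a b) ↔ (sat x a → sat x b) := by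
  rw [sat_eq]
  rfl

@[simp] theorem sat_box {x : OrdPoint N} {m : ℕ} {a : Formula} :
    sat x (box m a) ↔ ∀ y, Rel m x y → Good y → sat y a := by
  rw [sat_eq]
  rfl

open scoped Classical in
theorem sat_of_tautology (x : OrdPoint N) {φ : Formula} (h : Tautology φ) : sat x φ := by
  have := h (fun ψ => decide (sat x ψ)) (by
    refine ⟨by simp, by simp, by simp, by simp, fun a b => ?_⟩
    by_cases h : sat x a <;> simp [h])
  simpa using this

theorem sat_of_glp {φ : Formula} (h : GLP φ) : ∀ x : OrdPoint N, Good x → sat x φ := by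
  induction h with
  | taut h => exact fun x _ => sat_of_tautology x h
  | distr m φ ψ =>
    simp only [sat_imp, sat_box]
    exact fun x _ h₁ h₂ y hy hg => h₁ y hy hg (h₂ y hy hg)
  | lob m φ =>
    simp only [sat_imp, sat_box]
    intro x _ h y
    induction y using (wellFounded_rel m).induction with
    | _ y ih => exact fun hy hg => h y hy hg fun z hz hgz => ih z hz (hy.trans hz) hgz
  | mono m φ => exact fun x hx => sat_imp.2 (hx m φ)
  | diaMono m φ =>
    simp only [dia, sat_imp, sat_neg, sat_box, not_forall, not_not]
    rintro x _ ⟨z, ⟨h, hz, hz'⟩, hg, hφ⟩ y ⟨h', hy, _⟩ _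
    refine ⟨z, ⟨h, fun j hj => ?_, ?_⟩, hg, hφ⟩
    · rw [← hy j (by omega), hz j hj]
    · rwa [← hy ⟨m, h⟩ (by simp)]
  | mp _ _ ih₁ ih₂ => exact fun x hx => sat_imp.1 (ih₁ x hx) (ih₂ x hx)
  | nec m _ ih => exact fun x _ => sat_box.2 fun y _ hy => ih y hy

/-- Enlarging the initial segment of coordinate `j` from `< α j` to `≤ α j`, among the good
points that agree with `α` before `j`, does not destroy the validity of any formula. -/
def StableAt (α : OrdPoint N) (j : Fin (N + 1)) : Prop :=
  ∀ φ, (∀ y, Good y → (∀ i < j, y i = α i) → y j < α j → sat y φ) →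
    ∀ y, Good y → (∀ i < j, y i = α i) → y j ≤ α j → sat y φ

theorem exists_stableAt (k : ℕ) : ∃ α : OrdPoint N, ∀ j : Fin (N + 1), j.1 < k → StableAt α j := by
  induction k with
  | zero => exact ⟨0, by simp⟩
  | succ k ih =>
    obtain ⟨α, hα⟩ := ih
    by_cases hk : k < N + 1
    swap
    · exact ⟨α, fun j _ => hα j (by omega)⟩
    have hex : ∃ β : Ordinal.{0}, StableAt (Function.update α ⟨k, hk⟩ β) ⟨k, hk⟩ := by
      by_contra! hc
      simp only [StableAt, not_forall, Function.update_self] at hc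
      choose f hf y hy hy₁ hy₂ hy₃ using hc
      refine not_injective_of_ordinal f fun β γ hβγ => ?_
      have key : ∀ β γ, f β = f γ → ¬ β < γ := by
        intro β γ h hlt
        refine hy₃ β (h ▸ hf γ (y β) (hy β) (fun i hi => ?_) ((hy₂ β).trans_lt hlt))
        rw [hy₁ β i hi, Function.update_of_ne hi.ne, Function.update_of_ne hi.ne]
      exact le_antisymm (not_lt.1 (key γ β hβγ.symm)) (not_lt.1 (key β γ hβγ))
    obtain ⟨β, hβ⟩ := hex
    refine ⟨Function.update α ⟨k, hk⟩ β, fun j hj => ?_⟩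
    · rcases Nat.lt_succ_iff_lt_or_eq.1 hj with hj | hj
      · have h₁ : ∀ i ≤ j, Function.update α ⟨k, hk⟩ β i = α i := fun i hi =>
          Function.update_of_ne (by rintro rfl; have := Fin.le_def.1 hi; simp at this; omega) _ _
        have := hα j hj
        unfold StableAt at this ⊢
        rw [h₁ j le_rfl]
        have h₂ : ∀ y : OrdPoint N, (∀ i < j, y i = Function.update α ⟨k, hk⟩ β i) ↔
            ∀ i < j, y i = α i := fun y => forall₂_congr fun i hi => by rw [h₁ i hi.le]
        simpa only [h₂] using this
      · obtain rfl : j = ⟨k, hk⟩ := Fin.ext hj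
        exact hβ

theorem good_of_stableAt {α : OrdPoint N} (hα : ∀ j : Fin (N + 1), j.1 < N → StableAt α j)
    {x : OrdPoint N} (hx : ∀ j : Fin (N + 1), j.1 < N → x j = α j) : Good x := by
  intro m φ h
  rw [sat_box] at h ⊢
  rintro y ⟨hm, hy, _⟩ hg
  have hj : ∀ j : Fin (N + 1), j.1 ≤ m → y j = α j := fun j hj => by
    rw [← hy j (by omega), hx j (by omega)]
  refine hα ⟨m, by omega⟩ (by simpa using hm) φ (fun z hz hz₁ hz₂ => h z ⟨by omega, ?_, ?_⟩ hz)
    y hg (fun i hi => hj i (Fin.lt_def.1 hi).le) (hj _ le_rfl).le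
  · intro j hj
    rw [hz₁ j (Fin.lt_def.2 hj), hx j (by omega)]
  · rwa [hx _ (by simpa using hm)]

end OrdPoint

open OrdPoint in
/-- `GLP` does not refute `⟨N⟩⊤`. -/
theorem GLP.not_box_bot (N : ℕ) : ¬ GLP (box N bot) := by
  intro h
  obtain ⟨α, hα⟩ := exists_stableAt (N := N) N
  have hg : ∀ β, Good (Function.update α (Fin.last N) β) := fun β =>
    good_of_stableAt hα fun j hj => Function.update_of_ne (by rintro rfl; simp at hj) _ _
  have := sat_box.1 (sat_of_glp h _ (hg 1)) _ ⟨by omega, ?_, ?_⟩ (hg 0)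
  · exact sat_neg.1 this (sat_of_tautology _ fun v hv => hv.1)
  · intro j hj
    have : j ≠ Fin.last N := by rintro rfl; simp at hj
    rw [Function.update_of_ne this, Function.update_of_ne this]
  · have : (⟨N, by omega⟩ : Fin (N + 1)) = Fin.last N := rfl
    simp [this]

theorem GLP.not_iterate_box_bot (m k : ℕ) : ¬ GLP ((fun ψ => box m ψ)^[k] bot) := by
  have hL := GLP.extendsGLP
  intro h
  refine GLP.not_box_bot (m + 1) ((World.forall_mem_iff hL).1 fun w => ?_)
  by_contra hw
  have key : ∀ k, (fun ψ => box m ψ)^[k] bot ∉ w := by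
    intro k
    obtain ⟨v, hwv, -⟩ : ∃ v, World.Rel (m + 1) w v ∧ bot ∉ v := by
      simpa [World.box_mem hL] using hw
    induction k with
    | zero => exact World.bot_not_mem hL w
    | succ k ih =>
      rw [Function.iterate_succ_apply']
      intro hk
      cases k with
      | zero => exact World.bot_not_mem hL v (hwv.of_succ hL _ hk)
      | succ k =>
        rw [Function.iterate_succ_apply'] at ih hk
        exact ih ((hwv.box_iff hL (Nat.lt_succ_self m) _).2 (hwv.of_succ hL _ hk))
  exact key k (w.thm_mem h)

namespace World

/-- The linearity axioms allow one to treat the failure of finitely many boxes at a world as the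
failure of a single box. -/
theorem exists_box_not_mem (n : ℕ) (l : List Formula) :
    ∃ α : Formula, (∀ ψ ∈ l, ∀ y : World GLP3, ψ ∈ y → box n ψ ∈ y → α ∈ y) ∧
      ∀ w : World GLP3, box n bot ∉ w → (∀ ψ ∈ l, box n ψ ∉ w) → box n α ∉ w := by
  have hW := GLP3.extendsGLP
  induction l with
  | nil => exact ⟨bot, by simp, fun w h _ => h⟩
  | cons ψ l ih =>
    obtain ⟨α, hα, hα'⟩ := ih
    refine ⟨(α.and (box n α)).or (ψ.and (box n ψ)), ?_, ?_⟩
    · intro χ hχ y h₁ h₂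
      rw [or_mem hW, and_mem hW, and_mem hW]
      rcases List.mem_cons.1 hχ with rfl | hχ
      · exact Or.inr ⟨h₁, h₂⟩
      · exact Or.inl ⟨hα χ hχ y h₁ h₂, (box_mem hW).2 fun v hv =>
          hα χ hχ v (hv _ h₂) (hv _ (box_box_mem hW h₂))⟩
    · intro w hw hl h
      have h₁ := hα' w hw fun χ hχ => hl χ (List.mem_cons_of_mem _ hχ)
      have h₂ := hl ψ List.mem_cons_self
      rw [box_mem hW] at h h₁ h₂
      simp only [or_mem hW, and_mem hW] at h
      rcases (or_mem hW).1 (w.thm_mem (GLP3.lin n α ψ)) with hlin | hlin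
      · refine h₂ fun v hv => ?_
        rcases h v hv with h | h
        · exact imp_mem.1 (hv _ hlin) h.2
        · exact h.1
      · refine h₁ fun v hv => ?_
        rcases h v hv with h | h
        · exact h.1
        · exact imp_mem.1 (hv _ hlin) ((and_mem hW).2 ⟨h.2, h.1⟩)

theorem exists_rel_of_missing {Φ : Finset Formula} {n : ℕ} {w : World GLP3}
    (h : ∃ ψ ∈ Φ, box n ψ ∉ w) :
    ∃ y, Rel n w y ∧ (∀ ψ ∈ Φ, box n ψ ∉ w → ψ ∉ y ∨ box n ψ ∉ y) ∧
      (missing Φ n y).card < (missing Φ n w).card := by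
  have hW := GLP3.extendsGLP
  obtain ⟨ψ, hψ, hψw⟩ := h
  obtain ⟨α, hα, hα'⟩ := exists_box_not_mem n (missing Φ n w).toList
  simp only [Finset.mem_toList, mem_missing] at hα hα'
  have hbot : ∀ y : World GLP3, box n bot ∈ y → ∀ χ, box n χ ∈ y := fun y hy χ =>
    (box_mem hW).2 fun v hv => (bot_not_mem hW v (hv _ hy)).elim
  obtain ⟨y, hwy, hy, hy'⟩ := exists_rel_minimal hW
    (hα' w (fun h => hψw (hbot w h ψ)) fun χ hχ => hχ.2)
  refine ⟨y, hwy, fun χ hχ hχw => ?_, ?_⟩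
  · by_contra! hc
    exact hy' (hα χ ⟨hχ, hχw⟩ y hc.1 hc.2)
  · by_contra hc
    have hno : ∀ χ ∈ Φ, box n χ ∉ w → box n χ ∉ y := fun χ hχ hχw hχy =>
      hc (hwy.card_missing_lt hW hχ hχw hχy)
    exact hα' y (fun h => hno ψ hψ hψw (hbot y h ψ)) (fun χ hχ => hno χ hχ.1 hχ.2) hy

end World

open World

/-- A finite family of pairs of a `GLP3`-world and a closed formula. The formulas partition the
`GLP`-worlds refuting `⟨n⟩ρ`, and sending a `GLP`-world to the corresponding `GLP3`-world respects
the modalities `[m]` with `n ≤ m < N`, as far as formulas of `Φ` are concerned. -/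
structure Plane (Φ : Finset Formula) (N n : ℕ) (w : World GLP3) (ρ : Formula)
    (U : List (World GLP3 × Formula)) : Prop where
  root_mem : (w, ρ) ∈ U
  closed : ∀ p ∈ U, p.2.Closed
  cover : ∀ v : World GLP, (∃ p ∈ U, p.2 ∈ v) ∨ dia n ρ ∈ v
  not_dia : ∀ p ∈ U, ∀ v : World GLP, p.2 ∈ v → dia n ρ ∉ v
  inj : ∀ p ∈ U, ∀ q ∈ U, ∀ v : World GLP, p.2 ∈ v → q.2 ∈ v → p.1 = q.1
  forth : ∀ p ∈ U, ∀ m, n ≤ m → m < N → ∀ v v' : World GLP, Rel m v v' → p.2 ∈ v →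
    ∃ q ∈ U, q.2 ∈ v' ∧ Rel m p.1 q.1
  back : ∀ p ∈ U, ∀ m, n ≤ m → m < N → ∀ ψ ∈ Φ, box m ψ ∉ p.1 →
    ∃ q ∈ U, ψ ∉ q.1 ∧ ∀ v : World GLP, p.2 ∈ v → dia m q.2 ∈ v
  below_root : ∀ p ∈ U, p = (w, ρ) ∨ Rel n w p.1 ∧ ∀ v : World GLP, ρ ∈ v → dia n p.2 ∈ v
  dia_root : ∀ v : World GLP, dia N top ∈ v → dia n ρ ∈ v

/-- A family as in `Plane` which describes the `GLP`-worlds refuting `B`, and which is to be placed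
`[n]`-below `w`. -/
structure LowerPart (Φ : Finset Formula) (N n : ℕ) (w : World GLP3) (B : Formula)
    (V : List (World GLP3 × Formula)) : Prop where
  closed : ∀ p ∈ V, p.2.Closed
  closed_bound : B.Closed
  cover : ∀ v : World GLP, (∃ p ∈ V, p.2 ∈ v) ∨ B ∈ v
  not_bound : ∀ p ∈ V, ∀ v : World GLP, p.2 ∈ v → B ∉ v
  bound_iff : ∀ m, n < m → ∀ v v' : World GLP, Rel m v v' → (B ∈ v ↔ B ∈ v')
  bound_of_rel : ∀ v v' : World GLP, Rel n v v' → B ∈ v' → B ∈ v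
  bound_of_dia : ∀ v : World GLP, dia N top ∈ v → B ∈ v
  inj : ∀ p ∈ V, ∀ q ∈ V, ∀ v : World GLP, p.2 ∈ v → q.2 ∈ v → p.1 = q.1
  forth : ∀ p ∈ V, ∀ m, n ≤ m → m < N → ∀ v v' : World GLP, Rel m v v' → p.2 ∈ v →
    ∃ q ∈ V, q.2 ∈ v' ∧ Rel m p.1 q.1
  back : ∀ p ∈ V, ∀ m, n ≤ m → m < N → ∀ ψ ∈ Φ, box m ψ ∉ p.1 →
    ∃ q ∈ V, ψ ∉ q.1 ∧ ∀ v : World GLP, p.2 ∈ v → dia m q.2 ∈ v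
  below : ∀ p ∈ V, Rel n w p.1 ∧ ∀ v : World GLP, B ∈ v → dia n p.2 ∈ v
  exists_not_mem : ∀ ψ ∈ Φ, box n ψ ∉ w → ∃ p ∈ V, ψ ∉ p.1

theorem LowerPart.nil {Φ : Finset Formula} {N n : ℕ} {w : World GLP3}
    (h : ∀ ψ ∈ Φ, box n ψ ∈ w) : LowerPart Φ N n w top [] where
  closed := by simp
  closed_bound := trivial
  cover v := Or.inr (top_mem GLP.extendsGLP v)
  not_bound := by simp
  bound_iff _ _ v v' _ := by simp [top_mem GLP.extendsGLP]
  bound_of_rel v _ _ _ := top_mem GLP.extendsGLP v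
  bound_of_dia v _ := top_mem GLP.extendsGLP v
  inj := by simp
  forth := by simp
  back := by simp
  below := by simp
  exists_not_mem ψ hψ hw := (hw (h ψ hψ)).elim

namespace Plane

variable {Φ : Finset Formula} {N n : ℕ} {w : World GLP3} {ρ : Formula}
  {U : List (World GLP3 × Formula)}

theorem singleton (Φ : Finset Formula) (N : ℕ) (w : World GLP3) :
    Plane Φ N N w (box N bot) [(w, box N bot)] where
  root_mem := by simp
  closed := by simp [Closed, bot]
  cover v := by
    by_cases h : box N bot ∈ v
    · exact Or.inl ⟨_, List.mem_singleton_self _, h⟩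
    · obtain ⟨v', hv, hv', -⟩ := exists_rel_minimal GLP.extendsGLP h
      exact Or.inr ((dia_mem GLP.extendsGLP).2 ⟨v', hv, hv'⟩)
  not_dia := by
    simp only [List.mem_singleton, forall_eq]
    intro v hv h
    obtain ⟨v', hv', -⟩ := (dia_mem GLP.extendsGLP).1 h
    exact bot_not_mem GLP.extendsGLP v' (hv' _ hv)
  inj := by simp
  forth := by intros; omega
  back := by intros; omega
  below_root := by simp
  dia_root v hv := by
    have h : box N bot ∉ v := by
      intro h
      obtain ⟨v', hv', -⟩ := (dia_mem GLP.extendsGLP).1 hv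
      exact bot_not_mem GLP.extendsGLP v' (hv' _ h)
    obtain ⟨v', hv, hv', -⟩ := exists_rel_minimal GLP.extendsGLP h
    exact (dia_mem GLP.extendsGLP).2 ⟨v', hv, hv'⟩

theorem lowerPart (hU : Plane Φ N n w ρ U) (hn : n < N)
    {u : World GLP3} (hu : Rel n u w)
    (h : ∀ ψ ∈ Φ, box n ψ ∉ u → ψ ∉ w ∨ box n ψ ∉ w) : LowerPart Φ N n u (dia n ρ) U where
  closed := hU.closed
  closed_bound := hU.closed _ hU.root_mem
  cover := hU.cover
  not_bound := hU.not_dia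
  bound_iff m hm v v' hv := hv.dia_iff GLP.extendsGLP hm ρ
  bound_of_rel v v' hv h := by
    obtain ⟨v'', h₁, h₂⟩ := (dia_mem GLP.extendsGLP).1 h
    exact (dia_mem GLP.extendsGLP).2 ⟨v'', hv.trans GLP.extendsGLP h₁, h₂⟩
  bound_of_dia := hU.dia_root
  inj := hU.inj
  forth := hU.forth
  back := hU.back
  below p hp := by
    rcases hU.below_root p hp with rfl | ⟨h₁, h₂⟩
    · exact ⟨hu, fun _ h => h⟩
    · refine ⟨hu.trans GLP3.extendsGLP h₁, fun v hv => ?_⟩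
      obtain ⟨v', hv', h₃⟩ := (dia_mem GLP.extendsGLP).1 hv
      obtain ⟨v'', hv'', h₄⟩ := (dia_mem GLP.extendsGLP).1 (h₂ v' h₃)
      exact (dia_mem GLP.extendsGLP).2 ⟨v'', hv'.trans GLP.extendsGLP hv'', h₄⟩
  exists_not_mem ψ hψ hψu := by
    rcases h ψ hψ hψu with h | h
    · exact ⟨_, hU.root_mem, h⟩
    · obtain ⟨q, hq, hψq, -⟩ := hU.back _ hU.root_mem n le_rfl hn ψ hψ h
      exact ⟨q, hq, hψq⟩

theorem box_iff (hU : Plane Φ N (n + 1) w ρ U) {p : World GLP3 × Formula} (hp : p ∈ U)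
    (ψ : Formula) : box n ψ ∈ w ↔ box n ψ ∈ p.1 := by
  rcases hU.below_root p hp with rfl | ⟨h, -⟩
  · rfl
  · exact h.box_iff GLP3.extendsGLP (Nat.lt_succ_self n) ψ

theorem append_lowerPart {B : Formula} {V : List (World GLP3 × Formula)}
    (hU : Plane Φ N (n + 1) w ρ U) (hV : LowerPart Φ N n w B V) :
    ∃ ρ' U', Plane Φ N n w ρ' U' := by
  have hK := GLP.extendsGLP
  set A : Formula := B.and ρ with hA
  set γ : Formula → Formula := fun δ => B.and ((dia n A).neg.and δ) with hγ
  have hmemA : ∀ v : World GLP, A ∈ v ↔ B ∈ v ∧ ρ ∈ v := fun v => and_mem hK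
  have hmem : ∀ (v : World GLP) δ, γ δ ∈ v ↔ B ∈ v ∧ dia n A ∉ v ∧ δ ∈ v := fun v δ => by
    simp only [hγ, and_mem hK, neg_mem]
  have hrel : ∀ m, n < m → ∀ v v' : World GLP, Rel m v v' → ∀ δ, B ∈ v → dia n A ∉ v →
      δ ∈ v' → γ δ ∈ v' := fun m hm v v' hv δ h₁ h₂ h₃ =>
    (hmem v' δ).2 ⟨(hV.bound_iff m hm v v' hv).1 h₁, by rwa [← hv.dia_iff hK hm A], h₃⟩
  have hdia : ∀ v : World GLP, dia n (γ ρ) ∈ v ↔ dia n A ∈ v := by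
    intro v
    constructor
    · intro h
      obtain ⟨v', hv, hv'⟩ := (dia_mem hK).1 h
      exact (dia_mem hK).2 ⟨v', hv, (hmemA v').2 ⟨((hmem _ _).1 hv').1, ((hmem _ _).1 hv').2.2⟩⟩
    · intro h
      obtain ⟨v', hv, h₁, h₂⟩ := exists_rel_minimal hK (neg_mem.1 h)
      rw [neg_mem, not_not, hmemA] at h₂
      exact (dia_mem hK).2 ⟨v', hv, (hmem _ _).2 ⟨h₂.1, fun h => neg_mem.1 h h₁, h₂.2⟩⟩
  have hdiaA : ∀ v v' : World GLP, Rel n v v' → dia n A ∈ v' → dia n A ∈ v := by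
    intro v v' hv h
    obtain ⟨v'', h₁, h₂⟩ := (dia_mem hK).1 h
    exact (dia_mem hK).2 ⟨v'', hv.trans hK h₁, h₂⟩
  have hsucc : ∀ v : World GLP, B ∈ v → dia (n + 1) ρ ∈ v → dia n A ∈ v := by
    intro v hB h
    obtain ⟨v', hv, hv'⟩ := (dia_mem hK).1 h
    exact (dia_mem hK).2 ⟨v', hv.of_succ hK,
      (hmemA v').2 ⟨(hV.bound_iff _ (Nat.lt_succ_self n) v v' hv).1 hB, hv'⟩⟩
  refine ⟨γ ρ, U.map (fun p => (p.1, γ p.2)) ++ V, ?_⟩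
  have hmapU : ∀ p ∈ U, (p.1, γ p.2) ∈ U.map (fun p => (p.1, γ p.2)) ++ V := fun p hp =>
    List.mem_append_left _ (List.mem_map.2 ⟨p, hp, rfl⟩)
  have hcases : ∀ P : World GLP3 × Formula → Prop, (∀ p ∈ U, P (p.1, γ p.2)) → (∀ p ∈ V, P p) →
      ∀ p ∈ U.map (fun p => (p.1, γ p.2)) ++ V, P p := by
    intro P h₁ h₂ p hp
    rcases List.mem_append.1 hp with hp | hp
    · obtain ⟨q, hq, rfl⟩ := List.mem_map.1 hp
      exact h₁ q hq
    · exact h₂ p hp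
  have hmapV : ∀ p ∈ V, p ∈ U.map (fun p => (p.1, γ p.2)) ++ V := fun p hp =>
    List.mem_append_right _ hp
  constructor
  case root_mem => exact hmapU _ hU.root_mem
  case closed =>
    refine hcases _ (fun p hp => ?_) hV.closed
    have := hV.closed_bound
    have := hU.closed _ hU.root_mem
    have := hU.closed _ hp
    simp only [hγ, hA, dia, Closed]
    tauto
  case cover =>
    intro v
    rcases hV.cover v with ⟨p, hp, hpv⟩ | hB
    · exact Or.inl ⟨p, hmapV p hp, hpv⟩
    · by_cases hAv : dia n A ∈ v
      · exact Or.inr ((hdia v).2 hAv)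
      · rcases hU.cover v with ⟨p, hp, hpv⟩ | h
        · exact Or.inl ⟨_, hmapU p hp, (hmem _ _).2 ⟨hB, hAv, hpv⟩⟩
        · exact (hAv (hsucc v hB h)).elim
  case not_dia =>
    refine hcases _ (fun p hp v hv => ?_) (fun p hp v hv => ?_)
    · rw [hdia]
      exact ((hmem _ _).1 hv).2.1
    · rw [hdia, dia_mem hK]
      rintro ⟨v', hv', hA'⟩
      exact hV.not_bound p hp v hv (hV.bound_of_rel v v' hv' ((hmemA v').1 hA').1)
  case inj =>
    refine hcases _ (fun p hp => hcases _ (fun q hq v h₁ h₂ => ?_) (fun q hq v h₁ h₂ => ?_))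
      (fun p hp => hcases _ (fun q hq v h₁ h₂ => ?_) (hV.inj p hp))
    · exact hU.inj p hp q hq v ((hmem _ _).1 h₁).2.2 ((hmem _ _).1 h₂).2.2
    · exact (hV.not_bound q hq v h₂ ((hmem _ _).1 h₁).1).elim
    · exact (hV.not_bound p hp v h₁ ((hmem _ _).1 h₂).1).elim
  case forth =>
    refine hcases _ (fun p hp m hnm hm v v' hv h => ?_) (fun p hp m hnm hm v v' hv h => ?_)
    · obtain ⟨hB, hAv, hpv⟩ := (hmem _ _).1 h
      rcases hnm.lt_or_eq with hnm | rfl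
      · obtain ⟨q, hq, hqv, hpq⟩ := hU.forth p hp m hnm hm v v' hv hpv
        exact ⟨_, hmapU q hq, hrel m hnm v v' hv _ hB hAv hqv, hpq⟩
      · have hup : ∀ x, Rel n w x → Rel n p.1 x := fun x hx ψ hψ =>
          hx ψ ((hU.box_iff hp ψ).2 hψ)
        rcases hV.cover v' with ⟨q, hq, hqv⟩ | hB'
        · exact ⟨q, hmapV q hq, hqv, hup _ (hV.below q hq).1⟩
        · have hAv' : dia n A ∉ v' := fun h => hAv (hdiaA v v' hv h)
          rcases hU.cover v' with ⟨q, hq, hqv⟩ | h'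
          · refine ⟨_, hmapU q hq, (hmem _ _).2 ⟨hB', hAv', hqv⟩, hup _ ?_⟩
            rcases hU.below_root q hq with rfl | ⟨h, -⟩
            · exact (hAv ((dia_mem hK).2 ⟨v', hv, (hmemA v').2 ⟨hB', hqv⟩⟩)).elim
            · exact h.of_succ GLP3.extendsGLP
          · exact (hAv' (hsucc v' hB' h')).elim
    · obtain ⟨q, hq, h'⟩ := hV.forth p hp m hnm hm v v' hv h
      exact ⟨q, hmapV q hq, h'⟩
  case back =>
    refine hcases _ (fun p hp m hnm hm ψ hψ h => ?_) (fun p hp m hnm hm ψ hψ h => ?_)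
    · rcases hnm.lt_or_eq with hnm | rfl
      · obtain ⟨q, hq, hψq, hd⟩ := hU.back p hp m hnm hm ψ hψ h
        refine ⟨_, hmapU q hq, hψq, fun v hv => ?_⟩
        obtain ⟨hB, hAv, hpv⟩ := (hmem _ _).1 hv
        obtain ⟨v', hv', hqv⟩ := (dia_mem hK).1 (hd v hpv)
        exact (dia_mem hK).2 ⟨v', hv', hrel m hnm v v' hv' _ hB hAv hqv⟩
      · obtain ⟨q, hq, hψq⟩ := hV.exists_not_mem ψ hψ fun h' => h ((hU.box_iff hp ψ).1 h')
        exact ⟨q, hmapV q hq, hψq, fun v hv => (hV.below q hq).2 v ((hmem _ _).1 hv).1⟩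
    · obtain ⟨q, hq, h'⟩ := hV.back p hp m hnm hm ψ hψ h
      exact ⟨q, hmapV q hq, h'⟩
  case below_root =>
    refine hcases _ (fun p hp => ?_) (fun p hp => Or.inr ⟨(hV.below p hp).1, fun v hv =>
      (hV.below p hp).2 v ((hmem _ _).1 hv).1⟩)
    rcases hU.below_root p hp with rfl | ⟨h₁, h₂⟩
    · exact Or.inl rfl
    · refine Or.inr ⟨h₁.of_succ GLP3.extendsGLP, fun v hv => ?_⟩
      obtain ⟨hB, hAv, hρ⟩ := (hmem _ _).1 hv
      obtain ⟨v', hv', hpv⟩ := (dia_mem hK).1 (h₂ v hρ)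
      exact (dia_mem hK).2 ⟨v', hv'.of_succ hK,
        hrel _ (Nat.lt_succ_self n) v v' hv' _ hB hAv hpv⟩
  case dia_root =>
    exact fun v hv => (hdia v).2 (hsucc v (hV.bound_of_dia v hv) (hU.dia_root v hv))

theorem exists_of_add_eq (Φ : Finset Formula) (N d : ℕ) :
    ∀ n, n + d = N → ∀ w, ∃ ρ U, Plane Φ N n w ρ U := by
  induction d with
  | zero =>
    rintro n rfl w
    exact ⟨_, _, singleton Φ n w⟩
  | succ d ihd =>
    intro n hn w
    induction hc : (missing Φ n w).card using Nat.strong_induction_on generalizing w with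
    | _ c ihc =>
    obtain ⟨ρ, U, hU⟩ := ihd (n + 1) (by omega) w
    by_cases h : ∃ ψ ∈ Φ, box n ψ ∉ w
    · obtain ⟨y, hwy, hy, hlt⟩ := exists_rel_of_missing h
      obtain ⟨ρ', V, hV⟩ := ihc _ (hc ▸ hlt) y rfl
      exact hU.append_lowerPart (hV.lowerPart (by omega) hwy hy)
    · push Not at h
      exact hU.append_lowerPart (.nil h)

end Plane

namespace Formula

/-- Disjunction of a finite list of formulas. -/
def bigDisj (l : List Formula) : Formula := l.foldr or bot

theorem closed_bigDisj {l : List Formula} (h : ∀ φ ∈ l, φ.Closed) : (bigDisj l).Closed := by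
  induction l with
  | nil => trivial
  | cons φ l ih =>
    exact ⟨h φ List.mem_cons_self, ih fun ψ hψ => h ψ (List.mem_cons_of_mem _ hψ)⟩

end Formula

theorem World.bigDisj_mem {L : Formula → Prop} (hL : ExtendsGLP L) {w : World L}
    {l : List Formula} : bigDisj l ∈ w ↔ ∃ φ ∈ l, φ ∈ w := by
  induction l with
  | nil => simpa [bigDisj] using bot_not_mem hL w
  | cons φ l ih => simpa [bigDisj, or_mem hL] using or_congr_right ih

open scoped Classical in
/-- The closed substitution describing the variables true in the `GLP3`-worlds of a family. -/
noncomputable def planeSubst (U : List (World GLP3 × Formula)) (i : ℕ) : Formula :=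
  bigDisj ((U.filter fun p => var i ∈ p.1).map Prod.snd)

theorem mem_planeSubst {U : List (World GLP3 × Formula)} {i : ℕ} {v : World GLP} :
    planeSubst U i ∈ v ↔ ∃ p ∈ U, var i ∈ p.1 ∧ p.2 ∈ v := by
  simp only [planeSubst, bigDisj_mem GLP.extendsGLP, List.mem_map, List.mem_filter,
    decide_eq_true_eq]
  constructor
  · rintro ⟨_, ⟨p, hp, rfl⟩, hv⟩
    exact ⟨p, hp.1, hp.2, hv⟩
  · exact fun ⟨p, hp, hi, hv⟩ => ⟨_, ⟨p, ⟨hp, hi⟩, rfl⟩, hv⟩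

theorem Plane.subst_mem_iff {Φ : Finset Formula} {N : ℕ} {w : World GLP3} {ρ : Formula}
    {U : List (World GLP3 × Formula)} (hU : Plane Φ N 0 w ρ U) (hΦ : SubClosed Φ)
    (hN : ∀ ψ ∈ Φ, ψ.InLang N) {ψ : Formula} (hψ : ψ ∈ Φ) {p : World GLP3 × Formula} (hp : p ∈ U)
    {v : World GLP} (hv : p.2 ∈ v) : subst (planeSubst U) ψ ∈ v ↔ ψ ∈ p.1 := by
  have hK := GLP.extendsGLP
  have hW := GLP3.extendsGLP
  induction ψ generalizing p v with
  | var i =>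
    rw [subst, mem_planeSubst]
    constructor
    · rintro ⟨q, hq, hi, hqv⟩
      rwa [hU.inj p hp q hq v hv hqv]
    · exact fun hi => ⟨p, hp, hi, hv⟩
  | top => simp [subst, top_mem hK, top_mem hW]
  | neg a ih =>
    rw [subst, neg_mem, neg_mem]
    exact not_congr (ih (hΦ.neg hψ) hp hv)
  | and a b iha ihb =>
    rw [subst, and_mem hK, and_mem hW]
    exact and_congr (iha (hΦ.and hψ).1 hp hv) (ihb (hΦ.and hψ).2 hp hv)
  | or a b iha ihb =>
    rw [subst, or_mem hK, or_mem hW]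
    exact or_congr (iha (hΦ.or hψ).1 hp hv) (ihb (hΦ.or hψ).2 hp hv)
  | imp a b iha ihb =>
    rw [subst, imp_mem, imp_mem]
    exact imp_congr (iha (hΦ.imp hψ).1 hp hv) (ihb (hΦ.imp hψ).2 hp hv)
  | box m a ih =>
    have ha := hΦ.box hψ
    have hm := (hN _ hψ).1
    rw [subst]
    constructor
    · contrapose
      intro h
      obtain ⟨q, hq, haq, hd⟩ := hU.back p hp m (Nat.zero_le m) hm a ha h
      obtain ⟨v', hv', hqv⟩ := (dia_mem hK).1 (hd v hv)
      exact fun hbox => haq ((ih ha hq hqv).1 (hv' _ hbox))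
    · refine fun h => (box_mem hK).2 fun v' hv' => ?_
      obtain ⟨q, hq, hqv, hpq⟩ := hU.forth p hp m (Nat.zero_le m) hm v v' hv' hv
      exact (ih ha hq hqv).2 (hpq _ h)

/-- A formula unprovable in `GLP3` has a closed substitution instance whose provability is
refutable from `⟨N⟩⊤` for some `N`. -/
theorem exists_subst_of_not_glp3 {φ : Formula} (hφ : ¬ GLP3 φ) :
    ∃ σ : ℕ → Formula, (∀ i, (σ i).Closed) ∧
      ∃ N, GLP ((box 0 (subst σ φ)).imp (box N bot)) := by
  have hK := GLP.extendsGLP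
  obtain ⟨w, hw⟩ : ∃ w : World GLP3, φ ∉ w := by
    simpa using mt (forall_mem_iff GLP3.extendsGLP).1 hφ
  obtain ⟨N, hN⟩ := φ.exists_inLang
  obtain ⟨ρ, U, hU⟩ := Plane.exists_of_add_eq φ.subformulas N N 0 (by omega) w
  refine ⟨planeSubst U, fun i => closed_bigDisj ?_, N, (forall_mem_iff hK).1 fun v => ?_⟩
  · simp only [List.mem_map, List.mem_filter]
    rintro _ ⟨p, ⟨hp, -⟩, rfl⟩
    exact hU.closed p hp
  · rw [imp_mem]
    intro hbox
    by_contra h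
    have hd : dia N top ∈ v := by
      obtain ⟨v', hv, -⟩ := exists_rel_minimal hK h
      exact (dia_mem hK).2 ⟨v', hv, top_mem hK v'⟩
    obtain ⟨v', hv, hρ⟩ := (dia_mem hK).1 (hU.dia_root v hd)
    exact hw ((hU.subst_mem_iff φ.subClosed_subformulas (fun ψ hψ => hN.of_mem_subformulas hψ)
      φ.self_mem_subformulas hU.root_mem hρ).1 (hv _ hbox))

theorem Formula.closed_subst {σ : ℕ → Formula} (hσ : ∀ i, (σ i).Closed) (φ : Formula) :
    (subst σ φ).Closed := by
  induction φ with
  | var i => exact hσ i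
  | top => trivial
  | neg a ih | box m a ih => exact ih
  | and a b iha ihb | or a b iha ihb | imp a b iha ihb => exact ⟨iha, ihb⟩

theorem Formula.subst_iterate_box_bot (σ : ℕ → Formula) (m k : ℕ) :
    subst σ ((fun ψ => box m ψ)^[k] bot) = (fun ψ => box m ψ)^[k] bot := by
  induction k with
  | zero => rfl
  | succ k ih => rw [Function.iterate_succ_apply', subst, ih]

theorem Tautology.subst {φ : Formula} (h : Tautology φ) (σ : ℕ → Formula) :
    Tautology (φ.subst σ) := by
  rintro v ⟨ht, hn, ha, ho, hi⟩
  exact h (fun ψ => v (ψ.subst σ)) ⟨ht, fun a => hn _, fun a b => ha _ _, fun a b => ho _ _,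
    fun a b => hi _ _⟩

theorem GLP3.subst {φ : Formula} (h : GLP3 φ) (σ : ℕ → Formula) : GLP3 (φ.subst σ) := by
  induction h with
  | taut h => exact .taut (h.subst σ)
  | distr m φ ψ => exact .distr m _ _
  | lob m φ => exact .lob m _
  | mono m φ => exact .mono m _
  | diaMono m φ => exact .diaMono m _
  | lin m A B => exact .lin m _ _
  | mp _ _ ih₁ ih₂ => exact .mp ih₁ ih₂
  | nec m _ ih => exact .nec m ih

theorem GLP3.glp_subst {φ : Formula} (h : GLP3 φ) {σ : ℕ → Formula} (hσ : ∀ i, (σ i).Closed) :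
    GLP (φ.subst σ) := by
  induction h with
  | taut h => exact .taut (h.subst σ)
  | distr m φ ψ => exact .distr m _ _
  | lob m φ => exact .lob m _
  | mono m φ => exact .mono m _
  | diaMono m φ => exact .diaMono m _
  | lin m A B => exact GLP.lin_of_closed m (closed_subst hσ A) (closed_subst hσ B)
  | mp _ _ ih₁ ih₂ => exact .mp ih₁ ih₂
  | nec m _ ih => exact .nec m ih

theorem normalExtGLP_glp3 : NormalExtGLP {φ | GLP3 φ} :=
  ⟨fun _ => GLP3.of_glp, GLP3.distr, fun _ _ => GLP3.mp, fun m _ => GLP3.nec m,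
    fun σ _ h => GLP3.subst h σ⟩

theorem nonDegenerate_glp3 : NonDegenerate {φ | GLP3 φ} := by
  intro m k h
  refine GLP.not_iterate_box_bot m k ?_
  rw [← subst_iterate_box_bot (fun _ => top)]
  exact GLP3.glp_subst h fun _ => trivial

end ClosedSubstitutions

/-- For every `L_{[<ω]}`-formula `φ`, the following are equivalent:
(1) `φ` is a theorem of `GLP.3`;
(2) every closed substitution of `φ` is a theorem of `GLP`;
(3) `φ` is a theorem of some non-degenerate normal extension of `GLP`. -/
theorem glp3_tfae (φ : Formula) :
    (GLP3 φ ↔ ∀ σ : ℕ → Formula, (∀ i, Formula.Closed (σ i)) → GLP (Formula.subst σ φ)) ∧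
    (GLP3 φ ↔ ∃ S : Set Formula, NormalExtGLP S ∧ NonDegenerate S ∧ φ ∈ S) := by
  refine ⟨⟨fun h σ hσ => h.glp_subst hσ, fun h => ?_⟩,
    ⟨fun h => ⟨_, normalExtGLP_glp3, nonDegenerate_glp3, h⟩, ?_⟩⟩
  · by_contra hφ
    obtain ⟨σ, hσ, N, hN⟩ := exists_subst_of_not_glp3 hφ
    exact GLP.not_box_bot N (.mp hN (.nec 0 (h σ hσ)))
  · rintro ⟨S, ⟨hGLP, -, hmp, hnec, hsubst⟩, hS, h⟩
    by_contra hφ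
    obtain ⟨σ, hσ, N, hN⟩ := exists_subst_of_not_glp3 hφ
    exact hS N 1 (hmp _ _ (hGLP _ hN) (hnec 0 _ (hsubst σ φ h)))
end

section
/- Every theorem of J_n.lin is a theorem of GLP_n.3 (J_n.lin is a sublogic of GLP_n.3). -/
namespace GLPn3

open Formula

variable {n : ℕ}

theorem inLang {φ : Formula} (h : GLPn3 n φ) : InLang n φ := by
  induction h <;> simp_all [InLang, dia] <;> omega

theorem imp_trans {a b c : Formula} (hab : GLPn3 n (imp a b)) (hbc : GLPn3 n (imp b c)) :
    GLPn3 n (imp a c) := by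
  refine mp (mp (taut (φ := imp (imp a b) (imp (imp b c) (imp a c))) ?_ ?_) hab) hbc
  · rintro v ⟨-, -, -, -, hi⟩
    simp only [hi]
    cases v a <;> cases v b <;> cases v c <;> rfl
  · have := hab.inLang
    have := hbc.inLang
    simp_all [InLang]

theorem box_imp_box {m : ℕ} (hm : m < n) {a b : Formula} (h : GLPn3 n (imp a b)) :
    GLPn3 n (imp (box m a) (box m b)) :=
  mp (distr hm a b h.inLang.1 h.inLang.2) (nec hm h)

theorem or_mono {a b c d : Formula} (hac : GLPn3 n (imp a c)) (hbd : GLPn3 n (imp b d))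
    (h : GLPn3 n (or a b)) : GLPn3 n (or c d) := by
  refine mp (mp (mp (taut
    (φ := imp (imp a c) (imp (imp b d) (imp (or a b) (or c d)))) ?_ ?_) hac) hbd) h
  · rintro v ⟨-, -, -, ho, hi⟩
    simp only [hi, ho]
    cases v a <;> cases v b <;> cases v c <;> cases v d <;> rfl
  · have := hac.inLang
    have := hbd.inLang
    simp_all [InLang]

theorem box_imp_box_of_le {k m : ℕ} (hkm : k ≤ m) (hm : m < n) {φ : Formula}
    (hφ : InLang n φ) : GLPn3 n (imp (box k φ) (box m φ)) := by
  induction m, hkm using Nat.le_induction with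
  | base =>
    refine taut ?_ ⟨⟨hm, hφ⟩, hm, hφ⟩
    rintro v ⟨-, -, -, -, hi⟩
    simp [hi]
  | succ m hkm ih => exact imp_trans (ih (by omega)) (mono hm φ hφ)

/-- Transitivity of `[k]`, derived from Löb's axiom for `φ ∧ [k]φ`. -/
theorem box_imp_box_box {k : ℕ} (hk : k < n) {φ : Formula} (hφ : InLang n φ) :
    GLPn3 n (imp (box k φ) (box k (box k φ))) := by
  have hbφ : InLang n (box k φ) := ⟨hk, hφ⟩
  have hc : InLang n (and φ (box k φ)) := ⟨hφ, hbφ⟩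
  have hleft : GLPn3 n (imp (and φ (box k φ)) φ) := by
    refine taut ?_ ⟨hc, hφ⟩
    rintro v ⟨-, -, ha, -, hi⟩
    simp only [ha, hi]
    cases v φ <;> cases v (box k φ) <;> rfl
  have hright : GLPn3 n (imp (and φ (box k φ)) (box k φ)) := by
    refine taut ?_ ⟨hc, hbφ⟩
    rintro v ⟨-, -, ha, -, hi⟩
    simp only [ha, hi]
    cases v φ <;> cases v (box k φ) <;> rfl
  have hstep : GLPn3 n (imp φ (imp (box k (and φ (box k φ))) (and φ (box k φ)))) := by
    refine mp (taut (φ := imp (imp (box k (and φ (box k φ))) (box k φ))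
      (imp φ (imp (box k (and φ (box k φ))) (and φ (box k φ))))) ?_ ?_) (box_imp_box hk hleft)
    · rintro v ⟨-, -, ha, -, hi⟩
      simp only [ha, hi]
      cases v φ <;> cases v (box k φ) <;> cases v (box k (and φ (box k φ))) <;> rfl
    · simp [InLang, hφ, hk]
  exact imp_trans (imp_trans (box_imp_box hk hstep) (lob hk _ hc)) (box_imp_box hk hright)

theorem inLang_bigConj {l : List Formula} (h : ∀ φ ∈ l, InLang n φ) :
    InLang n (bigConj l) := by
  induction l with
  | nil => trivial
  | cons a l ih => exact ⟨h a (by simp), ih fun φ hφ => h φ (by simp [hφ])⟩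

theorem bigConj_imp {l : List Formula} (h : ∀ φ ∈ l, InLang n φ) {φ : Formula} (hφ : φ ∈ l) :
    GLPn3 n (imp (bigConj l) φ) := by
  refine taut ?_ ⟨inLang_bigConj h, h φ hφ⟩
  rintro v ⟨-, -, ha, -, hi⟩
  have key : ∀ l : List Formula, φ ∈ l → v (bigConj l) = true → v φ = true := by
    intro l
    induction l with
    | nil => simp
    | cons a l ih =>
      intro hmem hv
      have hv' : v a = true ∧ v (bigConj l) = true := by simpa [bigConj, ha] using hv
      rcases List.mem_cons.1 hmem with rfl | hmem
      · exact hv'.1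
      · exact ih hmem hv'.2
  have := key l hφ
  rw [hi]
  cases hl : v (bigConj l) <;> simp_all

theorem boxConj_imp_box {m : ℕ} (hm : m < n) {φ : Formula} (hφ : InLang n φ) :
    GLPn3 n (imp (boxConj m n φ) (box m φ)) := by
  refine bigConj_imp ?_ (List.mem_map.2 ⟨m, by simp [List.mem_range'_1]; omega, rfl⟩)
  intro χ hχ
  obtain ⟨k, hk, rfl⟩ := List.mem_map.1 hχ
  rw [List.mem_range'_1] at hk
  exact ⟨by omega, hφ⟩

theorem imp_imp_imp {a b c : Formula} (h : GLPn3 n (imp a b)) (hc : InLang n c) :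
    GLPn3 n (imp (imp b c) (imp a c)) := by
  refine mp (taut (φ := imp (imp a b) (imp (imp b c) (imp a c))) ?_ ?_) h
  · rintro v ⟨-, -, -, -, hi⟩
    simp only [hi]
    cases v a <;> cases v b <;> cases v c <;> rfl
  · have := h.inLang
    simp_all [InLang]

theorem and_imp_and {a b c : Formula} (h : GLPn3 n (imp a b)) (hc : InLang n c) :
    GLPn3 n (imp (and a c) (and b c)) := by
  refine mp (taut (φ := imp (imp a b) (imp (and a c) (and b c))) ?_ ?_) h
  · rintro v ⟨-, -, ha, -, hi⟩
    simp only [hi, ha]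
    cases v a <;> cases v b <;> cases v c <;> rfl
  · have := h.inLang
    simp_all [InLang]

theorem psLin {m : ℕ} (hm : m < n) {φ ψ : Formula} (hφ : InLang n φ) (hψ : InLang n ψ) :
    GLPn3 n (psLin n m φ ψ) :=
  or_mono (box_imp_box hm (imp_imp_imp (boxConj_imp_box hm hφ) hψ))
    (box_imp_box hm (imp_imp_imp (and_imp_and (boxConj_imp_box hm hψ) hψ) hφ))
    (lin hm φ ψ hφ hψ)

end GLPn3

/-- `J_n.lin` is a sublogic of `GLP_n.3`: every theorem of `J_n.lin` is a
theorem of `GLP_n.3`. -/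
theorem jnlin_sub_glpn3 (n : ℕ) (φ : Formula) (h : JnLin n φ) : GLPn3 n φ := by
  induction h with
  | taut ht hl => exact .taut ht hl
  | distr hk φ ψ hφ hψ => exact .distr hk φ ψ hφ hψ
  | lob hk φ hφ => exact .lob hk φ hφ
  | trans1 hkm hm φ hφ =>
    have hk := lt_of_le_of_lt hkm hm
    exact (GLPn3.box_imp_box_box hk hφ).imp_trans
      (.box_imp_box hk (.box_imp_box_of_le hkm hm hφ))
  | trans2 hkm hm φ hφ =>
    have hk := lt_of_le_of_lt hkm hm
    exact (GLPn3.box_imp_box_box hk hφ).imp_trans (.box_imp_box_of_le hkm hm ⟨hk, hφ⟩)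
  | diaMono hkm hm φ hφ =>
    exact (GLPn3.diaMono (lt_of_le_of_lt hkm hm) φ hφ).imp_trans
      (.box_imp_box_of_le hkm hm ⟨hkm.trans hm, hφ⟩)
  | lin hm φ ψ hφ hψ => exact .psLin hm hφ hψ
  | mp _ _ ih₁ ih₂ => exact .mp ih₁ ih₂
  | nec hk _ ih => exact .nec hk ih
end

section
/- Let (T, <_0, …, <_{n-1}) be a structure with n binary relations. Then T is a hereditarily linear J_n-frame if and only if: T forms a single ≡_0-equivalence class, and for each k < n, the relation <_k is compatible with ≡_{k+1} (i.e., x ≡_{k+1} x' and y ≡_{k+1} y' imply that x <_k y iff x' <_k y') and <_k induces a converse well-founded linear order on the (k+1)-planes contained in any given k-plane. -/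
section Planes

variable {T : Type*} {n : ℕ} {R : ℕ → T → T → Prop}

theorem eqvRel_of_lt {k : ℕ} (hk : k < n) :
    eqvRel R n k = Relation.EqvGen fun x y => R k x y ∨ eqvRel R n (k + 1) x y := by
  rw [eqvRel, dif_pos hk]

theorem eqvRel_self : eqvRel R n n = Eq := by
  rw [eqvRel, dif_neg (lt_irrefl n)]

theorem eqvRel_refl (k : ℕ) (x : T) : eqvRel R n k x x := by
  rw [eqvRel]
  split_ifs
  · exact .refl x
  · rfl

theorem eqvRel_mono {j k : ℕ} (hjk : j ≤ k) (hk : k ≤ n) {x y : T} (h : eqvRel R n k x y) :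
    eqvRel R n j x y := by
  induction hjk using Nat.decreasingInduction with
  | self => exact h
  | of_succ i hi ih =>
    rw [eqvRel_of_lt (hi.trans_le hk)]
    exact .rel _ _ (.inr ih)

theorem eqvRel_of_rel {k m : ℕ} (hkm : k ≤ m) (hm : m < n) {x y : T} (h : R m x y) :
    eqvRel R n k x y := by
  refine eqvRel_mono hkm hm.le ?_
  rw [eqvRel_of_lt hm]
  exact .rel _ _ (.inl h)

/-- `≡_k` is the least equivalence relation containing `<_m` for all `k ≤ m < n`. -/
theorem eqvRel_le_of_equivalence {S : T → T → Prop} (hS : Equivalence S) {k : ℕ} (hk : k ≤ n)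
    (h : ∀ m, k ≤ m → m < n → ∀ x y, R m x y → S x y) {x y : T} (hxy : eqvRel R n k x y) :
    S x y := by
  induction hk using Nat.decreasingInduction generalizing x y with
  | self =>
    rw [eqvRel_self] at hxy
    exact hxy ▸ hS.refl x
  | of_succ k hk ih =>
    rw [eqvRel_of_lt hk] at hxy
    induction hxy with
    | rel a b hab =>
      exact hab.elim (h k le_rfl hk a b)
        (ih fun m hm => h m (Nat.le_of_succ_le hm))
    | refl a => exact hS.refl a
    | symm a b _ hab => exact hS.symm hab
    | trans a b c _ _ hab hbc => exact hS.trans hab hbc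

/-- In a `J_n`-frame, `<_k` and `<_m` with `k < m` are disjoint. -/
theorem IsJnFrame.not_rel_of_rel (hJ : IsJnFrame n R) {k m : ℕ} (hkm : k < m) (hm : m < n)
    {x y : T} (h : R m x y) : ¬ R k x y := fun hk =>
  hJ.1 k (hkm.trans hm) x ((hJ.2.2.2 hkm hm).2.2 hk h)

/-- In a hereditarily linear `J_n`-frame, `<_k`-successors are preserved along `<_m`, `k < m`. -/
theorem IsJnFrame.rel_of_rel_left (hJ : IsJnFrame n R) (hL : HereditarilyLinear n R) {k m : ℕ}
    (hkm : k < m) (hm : m < n) {x x' y : T} (hx : R m x x') (hxy : R k x y) : R k x' y := by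
  have hk := hkm.trans hm
  by_cases heq : x' = y
  · subst heq
    exact absurd hxy (hJ.not_rel_of_rel hkm hm hx)
  obtain ⟨j, hj, h | h⟩ := hL x' y heq <;> rcases lt_trichotomy j k with hjk | rfl | hjk
  · exact absurd ((hJ.2.2.2 (hjk.trans hkm) hm).1 hx h) (hJ.not_rel_of_rel hjk hk hxy)
  · exact h
  · exact absurd ((hJ.2.2.2 hjk hj).2.2 hxy h) (hJ.not_rel_of_rel hkm hm hx)
  · exact absurd ((hJ.2.2.2 hjk hk).1 hxy h) (hJ.not_rel_of_rel (hjk.trans hkm) hm hx)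
  · exact absurd (hJ.2.1 j hk hxy h) (hJ.not_rel_of_rel hkm hm hx)
  · exact absurd ((hJ.2.2.2 hjk hj).2.1 hxy h) (hJ.not_rel_of_rel hkm hm hx)

theorem IsJnFrame.rel_congr (hJ : IsJnFrame n R) (hL : HereditarilyLinear n R) {k : ℕ}
    (hk : k < n) {x x' y y' : T} (hx : eqvRel R n (k + 1) x x') (hy : eqvRel R n (k + 1) y y') :
    R k x y ↔ R k x' y' := by
  have key : ∀ {a b : T}, eqvRel R n (k + 1) a b →
      ∀ z, (R k a z ↔ R k b z) ∧ (R k z a ↔ R k z b) := fun h =>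
    eqvRel_le_of_equivalence (S := fun a b => ∀ z, (R k a z ↔ R k b z) ∧ (R k z a ↔ R k z b))
      ⟨fun _ _ => ⟨Iff.rfl, Iff.rfl⟩, fun h z => ⟨(h z).1.symm, (h z).2.symm⟩,
        fun h₁ h₂ z => ⟨(h₁ z).1.trans (h₂ z).1, (h₁ z).2.trans (h₂ z).2⟩⟩ hk
      (fun m hkm hm a b hab z =>
        have hF := hJ.2.2.2 hkm hm
        ⟨⟨hJ.rel_of_rel_left hL hkm hm hab, hF.1 hab⟩,
          ⟨fun h => hF.2.1 h hab, fun h => hF.2.2 h hab⟩⟩) h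
  exact (key hx y).1.trans (key hy x').2

theorem IsJnFrame.not_rel_of_eqvRel (hJ : IsJnFrame n R) (hL : HereditarilyLinear n R) {k : ℕ}
    (hk : k < n) {x y : T} (h : eqvRel R n (k + 1) x y) : ¬ R k x y := fun hxy =>
  hJ.1 k hk y ((hJ.rel_congr hL hk h (eqvRel_refl _ y)).1 hxy)

theorem IsJnFrame.rel_or_rel_or_eqvRel (hJ : IsJnFrame n R) (hL : HereditarilyLinear n R) {k : ℕ}
    (hk : k < n) {x y : T} (h : eqvRel R n k x y) :
    R k x y ∨ R k y x ∨ eqvRel R n (k + 1) x y := by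
  have hsymm : ∀ {i : ℕ} {a b : T}, i < n → eqvRel R n i a b → eqvRel R n i b a := by
    intro i a b hi hab
    rw [eqvRel_of_lt hi] at hab ⊢
    exact hab.symm
  by_cases heq : x = y
  · exact .inr (.inr (heq ▸ eqvRel_refl _ x))
  obtain ⟨j, hj, hR⟩ := hL x y heq
  rcases lt_trichotomy j k with hjk | rfl | hjk
  · exact absurd hR (not_or.2
      ⟨hJ.not_rel_of_eqvRel hL hj (eqvRel_mono hjk hk.le h),
        hJ.not_rel_of_eqvRel hL hj (eqvRel_mono hjk hk.le (hsymm hk h))⟩)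
  · exact hR.imp_right .inl
  · exact .inr (.inr (hR.elim (eqvRel_of_rel hjk hj)
      fun h => hsymm (lt_of_le_of_lt hjk hj) (eqvRel_of_rel hjk hj h)))

end Planes

/-- Characterization of hereditarily linear `J_n`-frames: a structure with `n`
binary relations is a hereditarily linear `J_n`-frame iff `T` forms a single
`≡_0`-class and, for each `k < n`, the relation `<_k` is compatible with
`≡_{k+1}` and induces a converse well-founded (strict) linear order on the
`(k+1)`-planes within any given `k`-plane. -/
theorem heredLinear_characterization {T : Type*} (n : ℕ) (R : ℕ → T → T → Prop) :
    (IsJnFrame n R ∧ HereditarilyLinear n R) ↔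
    ((∀ x y : T, eqvRel R n 0 x y) ∧
     ∀ k, k < n →
       (∀ x x' y y' : T, eqvRel R n (k + 1) x x' → eqvRel R n (k + 1) y y' →
         (R k x y ↔ R k x' y')) ∧
       (∀ x y : T, eqvRel R n k x y → (R k x y ∨ R k y x ∨ eqvRel R n (k + 1) x y)) ∧
       (∀ x y : T, eqvRel R n (k + 1) x y → ¬ R k x y) ∧
       (∀ x y z : T, R k x y → R k y z → R k x z) ∧
       WellFounded (fun a b : T => R k b a)) := by
  constructor
  · rintro ⟨hJ, hL⟩
    refine ⟨fun x y => ?_, fun k hk => ⟨fun x x' y y' hx hy => hJ.rel_congr hL hk hx hy,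
      fun x y => hJ.rel_or_rel_or_eqvRel hL hk, fun x y => hJ.not_rel_of_eqvRel hL hk,
      fun _ _ _ hxy hyz => hJ.2.1 k hk hxy hyz, hJ.2.2.1 k hk⟩⟩
    by_cases heq : x = y
    · exact heq ▸ eqvRel_refl 0 x
    obtain ⟨k, hk, h | h⟩ := hL x y heq
    · exact eqvRel_of_rel k.zero_le hk h
    · have h₀ := eqvRel_of_rel k.zero_le hk h
      rw [eqvRel_of_lt (k.zero_le.trans_lt hk)] at h₀ ⊢
      exact h₀.symm
  · rintro ⟨h₀, h⟩
    refine ⟨⟨fun k hk x => (h k hk).2.2.1 x x (eqvRel_refl _ x),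
      fun k hk x y z => (h k hk).2.2.2.1 x y z, fun k hk => (h k hk).2.2.2.2,
      fun k m hkm hm => ?_⟩, fun x y hxy => ?_⟩
    · have hc := (h k (hkm.trans hm)).1
      have hR : ∀ {a b : T}, R m a b → eqvRel R n (k + 1) a b := eqvRel_of_rel hkm hm
      exact ⟨fun x y z hxy => (hc x y z z (hR hxy) (eqvRel_refl _ z)).2,
        fun x y z hxy hyz => (hc x x y z (eqvRel_refl _ x) (hR hyz)).1 hxy,
        fun x y z hxz hyz => (hc x x y z (eqvRel_refl _ x) (hR hyz)).2 hxz⟩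
    · by_contra! hno
      have hall : ∀ k ≤ n, eqvRel R n k x y := by
        intro k
        induction k with
        | zero => exact fun _ => h₀ x y
        | succ k ih =>
          intro hk
          exact (((h k hk).2.1 x y (ih (Nat.le_of_succ_le hk))).resolve_left
            (hno k hk).1).resolve_left (hno k hk).2
      have hn := hall n le_rfl
      rw [eqvRel_self] at hn
      exact hxy hn
end
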